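/- arXiv:2104.00110 — 4 statements merged into one kernel-verified Lean document; each statement's English description precedes it below -/
import Mathlib

section
/- Let f be a topologically transitive expanding Lorenz map with critical point c (convention f(c) = 0 for images of sets). Then f is strongly transitive in the following sense: for every nonempty open set U ⊆ [0,1] there exists k ∈ ℕ such that the union over 0 ≤ i ≤ k of the closures of the sets f^i(U) equals [0,1]. -/
open Set Filter Topology Function

/-- `f` is an expanding Lorenz map on `[a,b]` with critical point `c`:
continuous and strictly increasing on `[a,c)` and `(c,b]`, with
`lim_{x→c⁻} f(x) = b`, `lim_{x→c⁺} f(x) = a`, and differentiable with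
derivative uniformly greater than `1` outside a finite set. -/
structure IsExpandingLorenzOn (f : ℝ → ℝ) (c a b : ℝ) : Prop where
  a_lt_c : a < c
  c_lt_b : c < b
  mapsTo : Set.MapsTo f (Set.Icc a b) (Set.Icc a b)
  mono_left : StrictMonoOn f (Set.Ico a c)
  mono_right : StrictMonoOn f (Set.Ioc c b)
  cont_left : ContinuousOn f (Set.Ico a c)
  cont_right : ContinuousOn f (Set.Ioc c b)
  lim_left : Filter.Tendsto f (nhdsWithin c (Set.Iio c)) (nhds b)
  lim_right : Filter.Tendsto f (nhdsWithin c (Set.Ioi c)) (nhds a)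
  expanding : ∃ F : Set ℝ, F.Finite ∧ ∃ lam : ℝ, 1 < lam ∧
    ∀ x ∈ Set.Icc a b \ F, ∃ d : ℝ, HasDerivWithinAt f d (Set.Icc a b) x ∧ lam ≤ d

/-- An expanding Lorenz map on `[0,1]` with critical point `c`. -/
def IsExpandingLorenz (f : ℝ → ℝ) (c : ℝ) : Prop := IsExpandingLorenzOn f c 0 1

/-- A primary `n(k)`-cycle `z 0 < z 1 < ⋯ < z (n-k-1) < c < z (n-k) < ⋯ < z (n-1)`
for a Lorenz map `f` with critical point `c`. -/
structure IsPrimaryCycle (f : ℝ → ℝ) (c : ℝ) (n k : ℕ) (z : ℕ → ℝ) : Prop where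
  k_pos : 0 < k
  k_lt_n : k < n
  coprime : Nat.Coprime n k
  mem : ∀ i < n, z i ∈ Set.Icc (0:ℝ) 1
  mono : ∀ i j : ℕ, i < j → j < n → z i < z j
  left_of_c : ∀ i < n - k, z i < c
  right_of_c : ∀ i : ℕ, n - k ≤ i → i < n → c < z i
  step : ∀ i < n, f (z i) = z ((i + k) % n)
  le_f0 : z (k - 1) ≤ f 0
  f1_le : f 1 ≤ z k

/-- `g` is a renormalization `(f^l, f^r)` of the Lorenz map `f` on the
renormalization interval `[u,v]`: on `[u,c)` (resp. `(c,v]`) the map `g`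
is given by `f^[l]` (resp. `f^[r]`), with values given by one-sided limits
at points where some earlier iterate hits `c`, and `g` is itself an
expanding Lorenz map on `[u,v]` with critical point `c`. -/
structure IsRenormalization (f : ℝ → ℝ) (c : ℝ) (l r : ℕ) (u v : ℝ) (g : ℝ → ℝ) : Prop where
  one_lt_l : 1 < l
  one_lt_r : 1 < r
  u_nonneg : 0 ≤ u
  u_lt_c : u < c
  c_lt_v : c < v
  v_le_one : v ≤ 1
  proper : 0 < u ∨ v < 1
  eq_left : ∀ x ∈ Set.Ico u c, (∀ i < l, f^[i] x ≠ c) → g x = f^[l] x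
  eq_right : ∀ x ∈ Set.Ioc c v, (∀ i < r, f^[i] x ≠ c) → g x = f^[r] x
  lim_left_pt : ∀ x ∈ Set.Ico u c,
    Filter.Tendsto (f^[l]) (nhdsWithin x (Set.Ioi x)) (nhds (g x))
  lim_right_pt : ∀ x ∈ Set.Ioc c v,
    Filter.Tendsto (f^[r]) (nhdsWithin x (Set.Iio x)) (nhds (g x))
  lim_c_left : Filter.Tendsto (f^[l]) (nhdsWithin c (Set.Iio c)) (nhds v)
  lim_c_right : Filter.Tendsto (f^[r]) (nhdsWithin c (Set.Ioi c)) (nhds u)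
  lorenz : IsExpandingLorenzOn g c u v

/-- The forward orbit of `x` enters the set `S` with a `c`-free prefix:
there is `n ≥ 0` with `f^[i] x ≠ c` for `0 ≤ i < n` and `f^[n] x ∈ S`. -/
def CFreeEnters (f : ℝ → ℝ) (c : ℝ) (S : Set ℝ) (x : ℝ) : Prop :=
  ∃ n : ℕ, (∀ i < n, f^[i] x ≠ c) ∧ f^[n] x ∈ S

/-- `N(U) = min {n ≥ 0 : f^[n] z = c for some z ∈ U}`. -/
noncomputable def hitTime (f : ℝ → ℝ) (c : ℝ) (U : Set ℝ) : ℕ :=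
  sInf {n : ℕ | ∃ z ∈ U, f^[n] z = c}

/-- `x ∈ [0,1]` is a `c`-free periodic point of `f` of (exact) period `p`. -/
def IsCFreePeriodic (f : ℝ → ℝ) (c x : ℝ) (p : ℕ) : Prop :=
  x ∈ Set.Icc (0:ℝ) 1 ∧ f^[p] x = x ∧ (∀ i : ℕ, 0 < i → i < p → f^[i] x ≠ x) ∧
    ∀ i < p, f^[i] x ≠ c

/-- Topological transitivity of `f` as a map of `[0,1]`. -/
def LorenzTransitive (f : ℝ → ℝ) : Prop :=
  ∀ U V : Set ℝ, IsOpen U → IsOpen V →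
    (U ∩ Set.Icc 0 1).Nonempty → (V ∩ Set.Icc 0 1).Nonempty →
    ∃ n : ℕ, (f^[n] '' (U ∩ Set.Icc 0 1) ∩ (V ∩ Set.Icc 0 1)).Nonempty

/-- `f` is locally eventually onto: every nonempty (relatively) open subset of `[0,1]`
contains open intervals mapped homeomorphically onto `(0,c)` and onto `(c,1)`
by suitable iterates of `f`. -/
def LocallyEventuallyOnto (f : ℝ → ℝ) (c : ℝ) : Prop :=
  ∀ U : Set ℝ, IsOpen U → (U ∩ Set.Icc 0 1).Nonempty →
    (∃ a b : ℝ, a < b ∧ Set.Ioo a b ⊆ U ∩ Set.Icc 0 1 ∧ ∃ n : ℕ,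
      ContinuousOn (f^[n]) (Set.Ioo a b) ∧ Set.InjOn (f^[n]) (Set.Ioo a b) ∧
        f^[n] '' Set.Ioo a b = Set.Ioo 0 c) ∧
    (∃ a b : ℝ, a < b ∧ Set.Ioo a b ⊆ U ∩ Set.Icc 0 1 ∧ ∃ n : ℕ,
      ContinuousOn (f^[n]) (Set.Ioo a b) ∧ Set.InjOn (f^[n]) (Set.Ioo a b) ∧
        f^[n] '' Set.Ioo a b = Set.Ioo c 1)

/-- The generalized backward orbit of `x`: points joined to `x` by a chain
following `f`, where at the critical point `c` the chain may continue with
either `0` or `1`. -/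
def GenBackwardOrbit (f : ℝ → ℝ) (c x : ℝ) : Set ℝ :=
  {y | y ∈ Set.Icc (0:ℝ) 1 ∧ ∃ (k : ℕ) (w : ℕ → ℝ), w 0 = y ∧ w k = x ∧
    ∀ i < k, (w i ≠ c → w (i + 1) = f (w i)) ∧ (w i = c → w (i + 1) = 0 ∨ w (i + 1) = 1)}

/-- The two branches of an expanding Lorenz map on `[0,1]`, closed up at the critical point:
`f` is continuous and expanding on `[c,1]`, and `g`, which differs from `f` only at `c`, is
continuous and expanding on `[0,c]`. -/
structure LorenzBranches (f g : ℝ → ℝ) (c lam : ℝ) : Prop where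
  pos : 0 < c
  lt_one : c < 1
  one_lt : 1 < lam
  eq_of_ne : ∀ x, x ≠ c → g x = f x
  map_c : f c = 0
  map_c' : g c = 1
  mapsTo : MapsTo f (Icc 0 1) (Icc 0 1)
  cont_right : ContinuousOn f (Icc c 1)
  cont_left : ContinuousOn g (Icc 0 c)
  exp_right : ∀ x ∈ Icc c 1, ∀ y ∈ Icc c 1, x ≤ y → lam * (y - x) ≤ f y - f x
  exp_left : ∀ x ∈ Icc 0 c, ∀ y ∈ Icc 0 c, x ≤ y → lam * (y - x) ≤ g y - g x

theorem mul_sub_le_of_deriv_ge_off_finite {lam : ℝ} {F : Set ℝ} (hF : F.Finite) {h : ℝ → ℝ} :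
    ∀ {x y : ℝ}, x ≤ y → ContinuousOn h (Icc x y) →
      (∀ z ∈ Ioo x y \ F, ∃ d, HasDerivAt h d z ∧ lam ≤ d) → lam * (y - x) ≤ h y - h x := by
  induction F, hF using Set.Finite.induction_on with
  | empty =>
    intro x y hxy hcont hd
    rcases hxy.eq_or_lt with rfl | hlt
    · simp
    have hder : ∀ z ∈ Ioo x y, HasDerivAt h (deriv h z) z ∧ lam ≤ deriv h z := by
      intro z hz
      obtain ⟨d, h1, h2⟩ := hd z ⟨hz, by simp⟩
      rw [h1.deriv]
      exact ⟨h1, h2⟩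
    obtain ⟨z, hz, hz'⟩ := exists_hasDerivAt_eq_slope h (deriv h) hlt hcont
      (fun z hz => (hder z hz).1)
    have := (hder z hz).2
    rwa [hz', le_div_iff₀ (by linarith)] at this
  | @insert a F ha hF ih =>
    intro x y hxy hcont hd
    by_cases hay : a ∈ Ioo x y
    · have h1 : lam * (a - x) ≤ h a - h x := by
        refine ih hay.1.le (hcont.mono (Icc_subset_Icc_right hay.2.le)) fun z hz => hd z ?_
        refine ⟨⟨hz.1.1, hz.1.2.trans hay.2⟩, ?_⟩
        rintro (rfl | h)
        · exact lt_irrefl _ hz.1.2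
        · exact hz.2 h
      have h2 : lam * (y - a) ≤ h y - h a := by
        refine ih hay.2.le (hcont.mono (Icc_subset_Icc_left hay.1.le)) fun z hz => hd z ?_
        refine ⟨⟨hay.1.trans hz.1.1, hz.1.2⟩, ?_⟩
        rintro (rfl | h)
        · exact lt_irrefl _ hz.1.1
        · exact hz.2 h
      linarith
    · refine ih hxy hcont fun z hz => hd z ⟨hz.1, ?_⟩
      rintro (rfl | h)
      · exact hay hz.1
      · exact hz.2 h

theorem IsExpandingLorenz.exists_branches {f : ℝ → ℝ} {c : ℝ} (hf : IsExpandingLorenz f c)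
    (hc : f c = 0) : ∃ lam, LorenzBranches f (update f c 1) c lam := by
  obtain ⟨F, hF, lam, hlam, hd⟩ := hf.expanding
  have h0 := hf.a_lt_c
  have h1 := hf.c_lt_b
  have hder : ∀ z ∈ Ioo (0 : ℝ) 1 \ F, ∃ d, HasDerivAt f d z ∧ lam ≤ d := by
    intro z hz
    obtain ⟨d, hd1, hd2⟩ := hd z ⟨Ioo_subset_Icc_self hz.1, hz.2⟩
    exact ⟨d, hd1.hasDerivAt (Icc_mem_nhds hz.1.1 hz.1.2), hd2⟩
  have cr : ContinuousOn f (Icc c 1) := by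
    intro x hx
    rcases hx.1.eq_or_lt with rfl | hlt
    · have : ContinuousWithinAt f (Ioi c) c := by
        have := hf.lim_right
        rwa [← hc] at this
      exact (continuousWithinAt_Ioi_iff_Ici.1 this).mono Icc_subset_Ici_self
    · refine (hf.cont_right x ⟨hlt, hx.2⟩).mono_of_mem_nhdsWithin ?_
      filter_upwards [self_mem_nhdsWithin, nhdsWithin_le_nhds (Ioi_mem_nhds hlt)] with y hy hy'
      exact ⟨hy', hy.2⟩
  have cl : ContinuousOn (update f c 1) (Icc 0 c) := by
    intro x hx
    rcases hx.2.eq_or_lt with rfl | hlt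
    · rw [continuousWithinAt_update_same]
      refine hf.lim_left.mono_left (nhdsWithin_mono _ ?_)
      rintro y ⟨hy, hy'⟩
      exact lt_of_le_of_ne hy.2 hy'
    · rw [continuousWithinAt_update_of_ne hlt.ne]
      refine (hf.cont_left x ⟨hx.1, hlt⟩).mono_of_mem_nhdsWithin ?_
      filter_upwards [self_mem_nhdsWithin, nhdsWithin_le_nhds (Iio_mem_nhds hlt)] with y hy hy'
      exact ⟨hy.1, hy'⟩
  refine ⟨lam, h0, h1, hlam, fun x hx => update_of_ne hx _ _, hc, update_self _ _ _, hf.mapsTo,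
    cr, cl, ?_, ?_⟩
  · intro x hx y hy hxy
    refine mul_sub_le_of_deriv_ge_off_finite hF hxy (cr.mono (Icc_subset_Icc hx.1 hy.2)) ?_
    intro z hz
    exact hder z ⟨⟨h0.trans_le (hx.1.trans hz.1.1.le), hz.1.2.trans_le hy.2⟩, hz.2⟩
  · intro x hx y hy hxy
    refine mul_sub_le_of_deriv_ge_off_finite hF hxy (cl.mono (Icc_subset_Icc hx.1 hy.2)) ?_
    intro z hz
    have hzc : z < c := hz.1.2.trans_le hy.2
    obtain ⟨d, hd1, hd2⟩ := hder z ⟨⟨hx.1.trans_lt hz.1.1, hzc.trans h1⟩, hz.2⟩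
    refine ⟨d, hd1.congr_of_eventuallyEq ?_, hd2⟩
    filter_upwards [Iio_mem_nhds hzc] with w hw
    exact update_of_ne hw.ne _ _

namespace LorenzBranches

variable {f g : ℝ → ℝ} {c lam : ℝ}

theorem image_Ioo_of_expanding {h : ℝ → ℝ} {p q : ℝ} (hlam : 1 < lam) (hpq : p ≤ q)
    (hcont : ContinuousOn h (Icc p q))
    (hexp : ∀ x ∈ Icc p q, ∀ y ∈ Icc p q, x ≤ y → lam * (y - x) ≤ h y - h x) :
    h '' Ioo p q = Ioo (h p) (h q) := by
  refine Subset.antisymm ?_ (intermediate_value_Ioo hpq hcont)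
  rintro _ ⟨x, hx, rfl⟩
  have h1 := hexp p ⟨le_rfl, hpq⟩ x ⟨hx.1.le, hx.2.le⟩ hx.1.le
  have h2 := hexp x ⟨hx.1.le, hx.2.le⟩ q ⟨hpq, le_rfl⟩ hx.2.le
  constructor <;> nlinarith [hx.1, hx.2]

/-- An interval that avoids `c` is mapped onto an interval. -/
theorem image_Ioo (H : LorenzBranches f g c lam) {p q : ℝ} (hp : 0 ≤ p) (hpq : p < q)
    (hq : q ≤ 1) (hc : c ∉ Ioo p q) :
    f '' Ioo p q = Ioo (f p) (g q) ∧ lam * (q - p) ≤ g q - f p := by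
  rcases le_or_gt q c with hqc | hqc
  · have hsub : Icc p q ⊆ Icc 0 c := Icc_subset_Icc hp hqc
    have hgp : g p = f p := H.eq_of_ne p (by linarith)
    have himg : f '' Ioo p q = g '' Ioo p q :=
      image_congr fun x hx => (H.eq_of_ne x (hx.2.trans_le hqc).ne).symm
    rw [himg, ← hgp]
    exact ⟨image_Ioo_of_expanding H.one_lt hpq.le (H.cont_left.mono hsub)
      fun x hx y hy => H.exp_left x (hsub hx) y (hsub hy),
      H.exp_left p (hsub ⟨le_rfl, hpq.le⟩) q (hsub ⟨hpq.le, le_rfl⟩) hpq.le⟩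
  · have hcp : c ≤ p := not_lt.1 fun h => hc ⟨h, hqc⟩
    have hsub : Icc p q ⊆ Icc c 1 := Icc_subset_Icc hcp hq
    rw [H.eq_of_ne q hqc.ne']
    exact ⟨image_Ioo_of_expanding H.one_lt hpq.le (H.cont_right.mono hsub)
      fun x hx y hy => H.exp_right x (hsub hx) y (hsub hy),
      H.exp_right p (hsub ⟨le_rfl, hpq.le⟩) q (hsub ⟨hpq.le, le_rfl⟩) hpq.le⟩

theorem left_mem_Icc (H : LorenzBranches f g c lam) {x : ℝ} (hx : x ∈ Icc (0 : ℝ) 1) :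
    g x ∈ Icc (0 : ℝ) 1 := by
  by_cases h : x = c
  · rw [h, H.map_c']; simp
  · rw [H.eq_of_ne x h]; exact H.mapsTo hx

theorem mapsTo_iterate (H : LorenzBranches f g c lam) (n : ℕ) :
    MapsTo f^[n] (Icc 0 1) (Icc 0 1) :=
  H.mapsTo.iterate n

theorem iterate_Ioo (H : LorenzBranches f g c lam) {p q : ℝ} (hp : 0 ≤ p) (hpq : p < q)
    (hq : q ≤ 1) : ∀ n : ℕ, (∀ i < n, c ∉ Ioo (f^[i] p) (g^[i] q)) →
      0 ≤ f^[n] p ∧ f^[n] p < g^[n] q ∧ g^[n] q ≤ 1 ∧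
        f^[n] '' Ioo p q = Ioo (f^[n] p) (g^[n] q) ∧
        lam ^ n * (q - p) ≤ g^[n] q - f^[n] p := by
  intro n
  induction n with
  | zero => intro; simp [hp, hpq, hq]
  | succ n ih =>
    intro hn
    obtain ⟨h1, h2, h3, h4, h5⟩ := ih fun i hi => hn i (hi.trans n.lt_succ_self)
    obtain ⟨h6, h7⟩ := H.image_Ioo h1 h2 h3 (hn n n.lt_succ_self)
    have hl := H.one_lt
    simp only [iterate_succ_apply']
    refine ⟨(H.mapsTo ⟨h1, h2.le.trans h3⟩).1, by nlinarith,
      (H.left_mem_Icc ⟨h1.trans h2.le, h3⟩).2, ?_, ?_⟩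
    · rw [← h6, ← h4, image_image]
    · calc lam ^ (n + 1) * (q - p) = lam * (lam ^ n * (q - p)) := by ring
        _ ≤ lam * (g^[n] q - f^[n] p) := by gcongr
        _ ≤ _ := h7

/-- Every interval is mapped by a continuous iterate onto an interval around `c`. -/
theorem exists_hit (H : LorenzBranches f g c lam) {p q : ℝ} (hp : 0 ≤ p) (hpq : p < q)
    (hq : q ≤ 1) : ∃ n : ℕ, c ∈ Ioo (f^[n] p) (g^[n] q) ∧
      ∀ i < n, c ∉ Ioo (f^[i] p) (g^[i] q) := by
  have hex : ∃ n : ℕ, c ∈ Ioo (f^[n] p) (g^[n] q) := by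
    by_contra! hcon
    obtain ⟨n, hn⟩ := pow_unbounded_of_one_lt (1 / (q - p)) H.one_lt
    rw [div_lt_iff₀ (by linarith)] at hn
    obtain ⟨h1, -, h3, -, h5⟩ := H.iterate_Ioo hp hpq hq n fun i _ => hcon i
    linarith
  classical
  exact ⟨Nat.find hex, Nat.find_spec hex, fun i hi => Nat.find_min hex hi⟩

end LorenzBranches

/-- The points reached from `S` in at most `k` steps. -/
def reach (f : ℝ → ℝ) (S : Set ℝ) (k : ℕ) : Set ℝ := ⋃ i ∈ Iic k, f^[i] '' S

theorem reach_mono (f : ℝ → ℝ) (S : Set ℝ) : Monotone (reach f S) := fun _ _ h =>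
  biUnion_subset_biUnion_left (Iic_subset_Iic.2 h)

theorem image_iterate_subset_reach (f : ℝ → ℝ) (S : Set ℝ) (k : ℕ) :
    f^[k] '' S ⊆ reach f S k :=
  subset_biUnion_of_mem (u := fun i => f^[i] '' S) (self_mem_Iic (a := k))

theorem image_reach_subset (f : ℝ → ℝ) (S : Set ℝ) (k : ℕ) :
    f '' reach f S k ⊆ reach f S (k + 1) := by
  rintro _ ⟨x, hx, rfl⟩
  simp only [reach, mem_iUnion₂] at hx ⊢
  obtain ⟨i, hi, y, hy, rfl⟩ := hx
  exact ⟨i + 1, Nat.succ_le_succ hi, y, hy, iterate_succ_apply' f i y⟩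

/-- A left neighbourhood of `x` is reached from `S` in boundedly many steps. -/
def LeftCovered (f : ℝ → ℝ) (S : Set ℝ) (x : ℝ) : Prop :=
  ∃ k, ∃ a < x, Ioo a x ⊆ reach f S k

/-- A right neighbourhood of `x` is reached from `S` in boundedly many steps. -/
def RightCovered (f : ℝ → ℝ) (S : Set ℝ) (x : ℝ) : Prop :=
  ∃ k, ∃ b > x, Ioo x b ⊆ reach f S k

/-- The points of `(0,1)` covered from both sides. -/
def coveredSet (f : ℝ → ℝ) (S : Set ℝ) : Set ℝ :=
  {x ∈ Ioo 0 1 | LeftCovered f S x ∧ RightCovered f S x}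

theorem Ioo_subset_coveredSet {f : ℝ → ℝ} {S : Set ℝ} {p q : ℝ} {k : ℕ} (hp : 0 ≤ p)
    (hq : q ≤ 1) (h : Ioo p q ⊆ reach f S k) : Ioo p q ⊆ coveredSet f S := fun _ hx =>
  ⟨⟨hp.trans_lt hx.1, hx.2.trans_le hq⟩,
    ⟨k, p, hx.1, (Ioo_subset_Ioo_right hx.2.le).trans h⟩,
    ⟨k, q, hx.2, (Ioo_subset_Ioo_left hx.1.le).trans h⟩⟩

namespace LorenzBranches

variable {f g : ℝ → ℝ} {c lam : ℝ} {S : Set ℝ}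

theorem rightCovered_map (H : LorenzBranches f g c lam) {x : ℝ} (h0 : 0 ≤ x) (h1 : x < 1)
    (hx : RightCovered f S x) : RightCovered f S (f x) := by
  obtain ⟨k, b, hb, hsub⟩ := hx
  obtain ⟨b', hxb', hle, hlb, hcb'⟩ : ∃ b', x < b' ∧ b' ≤ 1 ∧ b' ≤ b ∧ c ∉ Ioo x b' := by
    by_cases hxc : x < c
    · exact ⟨min b c, lt_min hb hxc, (min_le_right _ _).trans H.lt_one.le, min_le_left _ _,
        fun h => (h.2.trans_le (min_le_right _ _)).false⟩
    · exact ⟨min b 1, lt_min hb h1, min_le_right _ _, min_le_left _ _, fun h => hxc h.1⟩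
  obtain ⟨h2, h3⟩ := H.image_Ioo h0 hxb' hle hcb'
  refine ⟨k + 1, g b', by nlinarith [H.one_lt], ?_⟩
  rw [← h2]
  exact (image_mono ((Ioo_subset_Ioo_right hlb).trans hsub)).trans (image_reach_subset f S k)

theorem leftCovered_map (H : LorenzBranches f g c lam) {x : ℝ} (h0 : 0 < x) (h1 : x ≤ 1)
    (hx : LeftCovered f S x) : LeftCovered f S (g x) := by
  obtain ⟨k, a, ha, hsub⟩ := hx
  obtain ⟨a', hxa', hge, hla, hca'⟩ : ∃ a', a' < x ∧ 0 ≤ a' ∧ a ≤ a' ∧ c ∉ Ioo a' x := by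
    by_cases hxc : c < x
    · exact ⟨max a c, max_lt ha hxc, H.pos.le.trans (le_max_right _ _), le_max_left _ _,
        fun h => ((le_max_right _ _).trans_lt h.1).false⟩
    · exact ⟨max a 0, max_lt ha h0, le_max_right _ _, le_max_left _ _, fun h => hxc h.2⟩
  obtain ⟨h2, h3⟩ := H.image_Ioo hge hxa' h1 hca'
  refine ⟨k + 1, f a', by nlinarith [H.one_lt], ?_⟩
  rw [← h2]
  exact (image_mono ((Ioo_subset_Ioo_left hla).trans hsub)).trans (image_reach_subset f S k)

theorem mapsTo_Ioo (H : LorenzBranches f g c lam) {x : ℝ} (hx : x ∈ Ioo (0 : ℝ) 1)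
    (hxc : x ≠ c) : f x ∈ Ioo (0 : ℝ) 1 := by
  have key : ∀ p q, 0 ≤ p → q ≤ 1 → x ∈ Ioo p q → c ∉ Ioo p q → f x ∈ Ioo (0 : ℝ) 1 := by
    intro p q hp hq hx' hcpq
    have hpq := hx'.1.trans hx'.2
    have hmem : f x ∈ Ioo (f p) (g q) :=
      (H.image_Ioo hp hpq hq hcpq).1 ▸ mem_image_of_mem f hx'
    exact ⟨(H.mapsTo ⟨hp, hpq.le.trans hq⟩).1.trans_lt hmem.1,
      hmem.2.trans_le (H.left_mem_Icc ⟨hp.trans hpq.le, hq⟩).2⟩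
  rcases hxc.lt_or_gt with h | h
  · exact key 0 c le_rfl H.lt_one.le ⟨hx.1, h⟩ (by simp)
  · exact key c 1 H.pos.le le_rfl ⟨h, hx.2⟩ (by simp)

theorem map_coveredSet (H : LorenzBranches f g c lam) {x : ℝ} (hx : x ∈ coveredSet f S)
    (hxc : x ≠ c) : f x ∈ coveredSet f S :=
  ⟨H.mapsTo_Ioo hx.1 hxc,
    H.eq_of_ne x hxc ▸ H.leftCovered_map hx.1.1 hx.1.2.le hx.2.1,
    H.rightCovered_map hx.1.1.le hx.1.2 hx.2.2⟩

theorem leftCovered_and_rightCovered_c (H : LorenzBranches f g c lam) {a b : ℝ} (ha : 0 ≤ a)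
    (hab : a < b) (hb : b ≤ 1) (hS : Ioo a b ⊆ S) :
    LeftCovered f S c ∧ RightCovered f S c := by
  obtain ⟨n, hn, hn'⟩ := H.exists_hit ha hab hb
  obtain ⟨h1, h2, h3, h4, -⟩ := H.iterate_Ioo ha hab hb n hn'
  have hsub : Ioo (f^[n] a) (g^[n] b) ⊆ reach f S n := by
    rw [← h4]
    exact (image_mono hS).trans (image_iterate_subset_reach f S n)
  exact (Ioo_subset_coveredSet h1 h3 hsub hn).2

/-- The intervals in the orbit of `(p,q)`, up to the first one that contains `c`. -/
theorem exists_orbit (H : LorenzBranches f g c lam) {O : Set ℝ}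
    (hO : ∀ x ∈ O, x ≠ c → f x ∈ O) {p q : ℝ} (hp : 0 ≤ p) (hpq : p < q) (hq : q ≤ 1)
    (hsub : Ioo p q ⊆ O) :
    ∃ P : Set (ℝ × ℝ), P.Finite ∧ (p, q) ∈ P ∧
      ∀ s ∈ P, 0 ≤ s.1 ∧ s.1 < s.2 ∧ s.2 ≤ 1 ∧ Ioo s.1 s.2 ⊆ O ∧
        (c ∉ Ioo s.1 s.2 → ∃ t ∈ P, f '' Ioo s.1 s.2 ⊆ Ioo t.1 t.2) := by
  obtain ⟨n, hn, hn'⟩ := H.exists_hit hp hpq hq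
  refine ⟨(fun i => (f^[i] p, g^[i] q)) '' Iic n, (finite_Iic n).image _, ⟨0, by simp, rfl⟩, ?_⟩
  rintro _ ⟨i, hi, rfl⟩
  have hit : ∀ j ≤ n, _ := fun j hj => H.iterate_Ioo hp hpq hq j
    fun k hk => hn' k (hk.trans_le hj)
  have hOi : ∀ j ≤ n, Ioo (f^[j] p) (g^[j] q) ⊆ O := by
    intro j
    induction j with
    | zero => intro _; simpa using hsub
    | succ j ih =>
      intro hj
      have hj' := (Nat.lt_of_succ_le hj)
      rw [← (hit _ hj).2.2.2.1, iterate_succ', image_comp, (hit _ hj'.le).2.2.2.1]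
      rintro _ ⟨x, hx, rfl⟩
      exact hO x (ih hj'.le hx) fun h => hn' j hj' (h ▸ hx)
  obtain ⟨h1, h2, h3, h4, -⟩ := hit i hi
  refine ⟨h1, h2, h3, hOi i hi, fun hc => ?_⟩
  have hin : i < n := lt_of_le_of_ne hi fun h => hc (h ▸ hn)
  refine ⟨_, ⟨i + 1, hin, rfl⟩, ?_⟩
  simp only [iterate_succ_apply']
  exact (H.image_Ioo h1 h2 h3 hc).1.subset

/-- A closed set that contains an interval and is forward invariant is everything. -/
theorem subset_of_isClosed_of_invariant (htrans : LorenzTransitive f) {K : Set ℝ}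
    (hK : IsClosed K) (hinv : ∀ x ∈ K ∩ Icc 0 1, f x ∈ K ∩ Icc 0 1) {a b : ℝ} (ha : 0 ≤ a)
    (hab : a < b) (hb : b ≤ 1) (hsub : Ioo a b ⊆ K) : Icc 0 1 ⊆ K := by
  by_contra hne
  obtain ⟨v, hv, hvK⟩ := not_subset.1 hne
  have hI : Ioo a b ⊆ Icc 0 1 := (Ioo_subset_Ioo ha hb).trans Ioo_subset_Icc_self
  obtain ⟨n, _, ⟨x, hx, rfl⟩, hx'⟩ := htrans (Ioo a b) Kᶜ isOpen_Ioo hK.isOpen_compl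
    ((nonempty_Ioo.2 hab).mono fun x hx => ⟨hx, hI hx⟩) ⟨v, hvK, hv⟩
  have : MapsTo f (K ∩ Icc 0 1) (K ∩ Icc 0 1) := hinv
  exact hx'.1 (this.iterate n ⟨hsub hx.1, hx.2⟩).1

theorem continuousWithinAt_of_ne (H : LorenzBranches f g c lam) {x : ℝ}
    (hx : x ∈ Icc (0 : ℝ) 1) (hxc : x ≠ c) : ContinuousWithinAt f (Icc 0 1) x := by
  rcases hxc.lt_or_gt with h | h
  · have h1 : ContinuousWithinAt g (Icc 0 1) x := by
      refine (H.cont_left x ⟨hx.1, h.le⟩).mono_of_mem_nhdsWithin ?_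
      filter_upwards [self_mem_nhdsWithin, nhdsWithin_le_nhds (Iio_mem_nhds h)] with y hy hy'
      exact ⟨hy.1, (mem_Iio.1 hy').le⟩
    refine h1.congr_of_eventuallyEq ?_ (H.eq_of_ne x hxc).symm
    filter_upwards [nhdsWithin_le_nhds (Iio_mem_nhds h)] with y hy
    exact (H.eq_of_ne y (mem_Iio.1 hy).ne).symm
  · refine (H.cont_right x ⟨h.le, hx.2⟩).mono_of_mem_nhdsWithin ?_
    filter_upwards [self_mem_nhdsWithin, nhdsWithin_le_nhds (Ioi_mem_nhds h)] with y hy hy'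
    exact ⟨(mem_Ioi.1 hy').le, hy.2⟩

/-- A finite family of intervals that is forward invariant off `c` has dense union. -/
theorem Icc_subset_closure_of_invariant (H : LorenzBranches f g c lam)
    (htrans : LorenzTransitive f) {V : Set ℝ} (hV : V ⊆ Icc 0 1)
    (hinv : ∀ x ∈ V, x ≠ c → f x ∈ V) {e : ℝ} (he : 0 < e) (he1 : e ≤ 1)
    (heV : Ioo 0 e ⊆ V) : Icc 0 1 ⊆ closure V := by
  refine subset_of_isClosed_of_invariant htrans isClosed_closure ?_ le_rfl he he1
    (heV.trans subset_closure)
  rintro x ⟨hxV, hx⟩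
  refine ⟨?_, H.mapsTo hx⟩
  by_cases hxc : x = c
  · rw [hxc, H.map_c]
    refine closure_mono heV ?_
    rw [closure_Ioo he.ne]
    exact ⟨le_rfl, he.le⟩
  · have hx' : x ∈ closure (V ∩ {c}ᶜ) := by
      rw [inter_comm]
      exact isOpen_compl_singleton.inter_closure ⟨hxc, hxV⟩
    refine ((H.continuousWithinAt_of_ne hx hxc).mono
      (inter_subset_left.trans hV)).mem_closure hx' ?_
    exact fun y hy => hinv y hy.1 hy.2

theorem finite_Icc_diff_coveredSet (H : LorenzBranches f g c lam) (htrans : LorenzTransitive f)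
    {a b : ℝ} (ha : 0 ≤ a) (hab : a < b) (hb : b ≤ 1) (hS : Ioo a b ⊆ S) :
    (Icc 0 1 \ coveredSet f S).Finite := by
  obtain ⟨hcl, hcr⟩ := H.leftCovered_and_rightCovered_c ha hab hb hS
  have hr0 : RightCovered f S 0 := H.map_c ▸ H.rightCovered_map H.pos.le H.lt_one hcr
  have hl1 : LeftCovered f S 1 := H.map_c' ▸ H.leftCovered_map H.pos H.lt_one.le hcl
  set O := coveredSet f S
  have hO : ∀ x ∈ O, x ≠ c → f x ∈ O := fun x hx hxc => H.map_coveredSet hx hxc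
  obtain ⟨e, he0, he1, heO, hemax⟩ : ∃ e, 0 < e ∧ e ≤ 1 ∧ Ioo 0 e ⊆ O ∧
      ∀ t ≤ 1, Ioo 0 t ⊆ O → t ≤ e := by
    obtain ⟨k, b', hb', hsub⟩ := hr0
    have hbdd : BddAbove {t : ℝ | t ≤ 1 ∧ Ioo 0 t ⊆ O} := ⟨1, fun t ht => ht.1⟩
    have hmem : min b' 1 ∈ {t : ℝ | t ≤ 1 ∧ Ioo 0 t ⊆ O} :=
      ⟨min_le_right _ _, Ioo_subset_coveredSet le_rfl (min_le_right _ _)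
        ((Ioo_subset_Ioo_right (min_le_left _ _)).trans hsub)⟩
    refine ⟨sSup {t : ℝ | t ≤ 1 ∧ Ioo 0 t ⊆ O},
      (lt_min hb' one_pos).trans_le (le_csSup hbdd hmem), csSup_le ⟨_, hmem⟩ fun t ht => ht.1,
      fun x hx => ?_, fun t ht ht' => le_csSup hbdd ⟨ht, ht'⟩⟩
    obtain ⟨t, ht, hxt⟩ := exists_lt_of_lt_csSup ⟨_, hmem⟩ hx.2
    exact ht.2 ⟨hx.1, hxt⟩
  obtain ⟨d, hd1, hd0, hdO, hdmin⟩ : ∃ d, d < 1 ∧ 0 ≤ d ∧ Ioo d 1 ⊆ O ∧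
      ∀ t, 0 ≤ t → Ioo t 1 ⊆ O → d ≤ t := by
    obtain ⟨k, a', ha', hsub⟩ := hl1
    have hbdd : BddBelow {t : ℝ | 0 ≤ t ∧ Ioo t 1 ⊆ O} := ⟨0, fun t ht => ht.1⟩
    have hmem : max a' 0 ∈ {t : ℝ | 0 ≤ t ∧ Ioo t 1 ⊆ O} :=
      ⟨le_max_right _ _, Ioo_subset_coveredSet (le_max_right _ _) le_rfl
        ((Ioo_subset_Ioo_left (le_max_left _ _)).trans hsub)⟩
    refine ⟨sInf {t : ℝ | 0 ≤ t ∧ Ioo t 1 ⊆ O},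
      (csInf_le hbdd hmem).trans_lt (max_lt ha' one_pos), le_csInf ⟨_, hmem⟩ fun t ht => ht.1,
      fun x hx => ?_, fun t ht ht' => csInf_le hbdd ⟨ht, ht'⟩⟩
    obtain ⟨t, ht, hxt⟩ := exists_lt_of_csInf_lt ⟨_, hmem⟩ hx.1
    exact ht.2 ⟨hxt, hx.2⟩
  obtain ⟨P, hPfin, hPe, hP⟩ := H.exists_orbit hO le_rfl he0 he1 heO
  obtain ⟨Q, hQfin, hQd, hQ⟩ := H.exists_orbit hO hd0 hd1 le_rfl hdO
  set R := P ∪ Q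
  have hRfin : R.Finite := hPfin.union hQfin
  have hR : ∀ s ∈ R, 0 ≤ s.1 ∧ s.1 < s.2 ∧ s.2 ≤ 1 ∧ Ioo s.1 s.2 ⊆ O ∧
      (c ∉ Ioo s.1 s.2 → ∃ t ∈ R, f '' Ioo s.1 s.2 ⊆ Ioo t.1 t.2) := by
    rintro s (hs | hs)
    · obtain ⟨h1, h2, h3, h4, h5⟩ := hP s hs
      exact ⟨h1, h2, h3, h4, fun h => (h5 h).imp fun t ht => ⟨Or.inl ht.1, ht.2⟩⟩
    · obtain ⟨h1, h2, h3, h4, h5⟩ := hQ s hs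
      exact ⟨h1, h2, h3, h4, fun h => (h5 h).imp fun t ht => ⟨Or.inr ht.1, ht.2⟩⟩
  have hinv : ∀ x ∈ ⋃ s ∈ R, Ioo s.1 s.2, x ≠ c → f x ∈ ⋃ s ∈ R, Ioo s.1 s.2 := by
    intro x hx hxc
    obtain ⟨s, hs, hxs⟩ := mem_iUnion₂.1 hx
    obtain ⟨h1, h2, h3, h4, h5⟩ := hR s hs
    by_cases hcs : c ∈ Ioo s.1 s.2
    · rcases hxc.lt_or_gt with hlt | hlt
      · have him := (H.image_Ioo h1 hcs.1 H.lt_one.le (by simp)).1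
        rw [H.map_c'] at him
        have hds : d ≤ f s.1 := by
          refine hdmin _ (H.mapsTo ⟨h1, h2.le.trans h3⟩).1 ?_
          rw [← him]
          rintro _ ⟨y, hy, rfl⟩
          exact hO y (h4 ⟨hy.1, hy.2.trans hcs.2⟩) hy.2.ne
        have hfx : f x ∈ Ioo (f s.1) 1 := him ▸ mem_image_of_mem f ⟨hxs.1, hlt⟩
        exact mem_iUnion₂.2 ⟨(d, 1), Or.inr hQd, hds.trans_lt hfx.1, hfx.2⟩
      · have him := (H.image_Ioo H.pos.le hcs.2 h3 (by simp)).1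
        rw [H.map_c] at him
        have hes : g s.2 ≤ e := by
          refine hemax _ (H.left_mem_Icc ⟨h1.trans h2.le, h3⟩).2 ?_
          rw [← him]
          rintro _ ⟨y, hy, rfl⟩
          exact hO y (h4 ⟨hcs.1.trans hy.1, hy.2⟩) hy.1.ne'
        have hfx : f x ∈ Ioo 0 (g s.2) := him ▸ mem_image_of_mem f ⟨hlt, hxs.2⟩
        exact mem_iUnion₂.2 ⟨(0, e), Or.inl hPe, hfx.1, hfx.2.trans_le hes⟩
    · obtain ⟨t, ht, hst⟩ := h5 hcs
      exact mem_iUnion₂.2 ⟨t, ht, hst (mem_image_of_mem f hxs)⟩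
  have hdense : Icc 0 1 ⊆ closure (⋃ s ∈ R, Ioo s.1 s.2) := by
    refine H.Icc_subset_closure_of_invariant htrans ?_ hinv he0 he1 ?_
    · refine iUnion₂_subset fun s hs => ?_
      exact (Ioo_subset_Ioo (hR s hs).1 (hR s hs).2.2.1).trans Ioo_subset_Icc_self
    · exact fun x hx => mem_iUnion₂.2 ⟨(0, e), Or.inl hPe, hx⟩
  refine ((hRfin.image Prod.fst).union (hRfin.image Prod.snd)).subset ?_
  rintro x ⟨hx, hxO⟩
  have hx' := hdense hx
  rw [hRfin.closure_biUnion] at hx'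
  obtain ⟨s, hs, hxs⟩ := mem_iUnion₂.1 hx'
  obtain ⟨-, h2, -, h4, -⟩ := hR s hs
  rw [closure_Ioo h2.ne] at hxs
  rcases hxs.1.eq_or_lt with h | h
  · exact Or.inl ⟨s, hs, h⟩
  rcases hxs.2.eq_or_lt with h' | h'
  · exact Or.inr ⟨s, hs, h'.symm⟩
  exact absurd (h4 ⟨h, h'⟩) hxO

/-- A nonempty open set that is backward invariant meets every interval. -/
theorem inter_Ioo_nonempty_of_backward_invariant (H : LorenzBranches f g c lam)
    (htrans : LorenzTransitive f) {V : Set ℝ}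
    (hV : IsOpen V) (hne : (V ∩ Icc 0 1).Nonempty) (hinv : ∀ y ∈ Icc (0 : ℝ) 1, f y ∈ V → y ∈ V)
    {a b : ℝ} (ha : 0 ≤ a) (hab : a < b) (hb : b ≤ 1) : (Ioo a b ∩ V).Nonempty := by
  have hI : Ioo a b ⊆ Icc 0 1 := (Ioo_subset_Ioo ha hb).trans Ioo_subset_Icc_self
  obtain ⟨n, _, ⟨x, hx, rfl⟩, hx'⟩ := htrans (Ioo a b) V isOpen_Ioo hV
    ((nonempty_Ioo.2 hab).mono fun x hx => ⟨hx, hI hx⟩) hne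
  refine ⟨x, hx.1, ?_⟩
  have : ∀ n : ℕ, f^[n] x ∈ V → x ∈ V := by
    intro n
    induction n with
    | zero => exact id
    | succ n ih =>
      intro h
      rw [iterate_succ_apply'] at h
      exact ih (hinv _ (H.mapsTo_iterate n hx.2) h)
  exact this n hx'.1

theorem leftCovered (H : LorenzBranches f g c lam) (htrans : LorenzTransitive f)
    {a b : ℝ} (ha : 0 ≤ a) (hab : a < b) (hb : b ≤ 1) (hS : Ioo a b ⊆ S) {x : ℝ}
    (hx : x ∈ Ioc (0 : ℝ) 1) : LeftCovered f S x := by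
  by_contra hxl
  set B := {p ∈ Ioc (0 : ℝ) 1 | ¬ LeftCovered f S p}
  have hBfin : B.Finite := (H.finite_Icc_diff_coveredSet htrans ha hab hb hS).subset
    fun p hp => ⟨Ioc_subset_Icc_self hp.1, fun h => hp.2 h.2.1⟩
  obtain ⟨ε, hε, hεab, hεB⟩ : ∃ ε > 0, ε < (b - a) / 2 ∧
      ∀ p ∈ B, ε < p ∧ (f 1 < p → ε < p - f 1) := by
    have h1 : ∀ᶠ ε in 𝓝[>] (0 : ℝ), ∀ p ∈ B, ε < p ∧ (f 1 < p → ε < p - f 1) := by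
      refine (eventually_all_finite hBfin).2 fun p hp => nhdsWithin_le_nhds ?_
      refine (eventually_lt_nhds hp.1.1).and ?_
      by_cases h : f 1 < p
      · filter_upwards [eventually_lt_nhds (sub_pos.2 h)] with ε h' _ using h'
      · exact Eventually.of_forall fun _ h' => absurd h' h
    have h2 : ∀ᶠ ε in 𝓝[>] (0 : ℝ), ε < (b - a) / 2 :=
      nhdsWithin_le_nhds (eventually_lt_nhds (by linarith))
    obtain ⟨ε, h3, h4, h5⟩ := (h1.and (h2.and self_mem_nhdsWithin)).exists
    exact ⟨ε, h5, h4, h3⟩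
  have hI := Ioo_subset_coveredSet ha hb
    (hS.trans (by simpa using image_iterate_subset_reach f S 0))
  set V := ⋃ p ∈ B, Ioo (p - ε) p
  have hVne : (V ∩ Icc 0 1).Nonempty := by
    refine ⟨x - ε / 2, mem_iUnion₂.2 ⟨x, ⟨hx, hxl⟩, by constructor <;> linarith⟩, ?_⟩
    have := (hεB x ⟨hx, hxl⟩).1
    constructor <;> linarith [hx.2]
  have hVinv : ∀ y ∈ Icc (0 : ℝ) 1, f y ∈ V → y ∈ V := by
    intro y hy hyV
    obtain ⟨p, hp, hyp⟩ := mem_iUnion₂.1 hyV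
    obtain ⟨hεp, hεp'⟩ := hεB p hp
    have hl := H.one_lt
    suffices h : ∃ y' ∈ Ioc (0 : ℝ) 1, y ≤ y' ∧ g y' = p ∧ lam * (y' - y) ≤ p - f y by
      obtain ⟨y', h1, h2, h3, h4⟩ := h
      refine mem_iUnion₂.2 ⟨y', ⟨h1, fun h => hp.2 (h3 ▸ H.leftCovered_map h1.1 h1.2 h)⟩, ?_⟩
      have hne : y ≠ y' := by
        rintro rfl
        by_cases hyc : y = c
        · rw [hyc, H.map_c] at hyp
          linarith [hyp.1]
        · exact hyp.2.ne ((H.eq_of_ne y hyc).symm.trans h3)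
      exact ⟨by nlinarith [hyp.1], lt_of_le_of_ne h2 hne⟩
    rcases lt_trichotomy y c with hyc | hyc | hyc
    · have hgy := H.eq_of_ne y hyc.ne
      obtain ⟨y', hy', hyp'⟩ := intermediate_value_Icc hyc.le
        (H.cont_left.mono (Icc_subset_Icc_left hy.1))
        (show p ∈ Icc (g y) (g c) from ⟨hgy ▸ hyp.2.le, H.map_c' ▸ hp.1.2⟩)
      have hexp := H.exp_left y ⟨hy.1, hyc.le⟩ y' ⟨hy.1.trans hy'.1, hy'.2⟩ hy'.1
      rw [hgy, hyp'] at hexp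
      refine ⟨y', ⟨lt_of_le_of_ne (hy.1.trans hy'.1) ?_, hy'.2.trans H.lt_one.le⟩, hy'.1, hyp',
        hexp⟩
      rintro h0
      have hy0 : y = y' := le_antisymm hy'.1 (h0 ▸ hy.1)
      rw [← hy0, hgy] at hyp'
      exact hyp.2.ne hyp'
    · rw [hyc, H.map_c] at hyp
      linarith [hyp.1]
    · have hfy : f y ≤ f 1 := by
        have := H.exp_right y ⟨hyc.le, hy.2⟩ 1 ⟨H.lt_one.le, le_rfl⟩ hy.2
        nlinarith [hy.2]
      have hpf : p ≤ f 1 := by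
        by_contra! h
        linarith [hεp' h, hyp.1]
      obtain ⟨y', hy', hyp'⟩ := intermediate_value_Icc hy.2
        (H.cont_right.mono (Icc_subset_Icc_left hyc.le)) ⟨hyp.2.le, hpf⟩
      have hexp := H.exp_right y ⟨hyc.le, hy.2⟩ y' ⟨hyc.le.trans hy'.1, hy'.2⟩ hy'.1
      have hcy' := hyc.trans_le hy'.1
      rw [hyp'] at hexp
      exact ⟨y', ⟨H.pos.trans hcy', hy'.2⟩, hy'.1, (H.eq_of_ne y' hcy'.ne').trans hyp', hexp⟩
  obtain ⟨y, hy, hyV⟩ := H.inter_Ioo_nonempty_of_backward_invariant htrans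
    (isOpen_biUnion fun p _ => isOpen_Ioo) hVne hVinv ha
    (show a < (a + b) / 2 by linarith) (by linarith)
  obtain ⟨p, hp, hyp⟩ := mem_iUnion₂.1 hyV
  refine hp.2 (hI ⟨hy.1.trans hyp.2, ?_⟩).2.1
  linarith [hy.2, hyp.1]

theorem rightCovered (H : LorenzBranches f g c lam) (htrans : LorenzTransitive f)
    {a b : ℝ} (ha : 0 ≤ a) (hab : a < b) (hb : b ≤ 1) (hS : Ioo a b ⊆ S) {x : ℝ}
    (hx : x ∈ Ico (0 : ℝ) 1) : RightCovered f S x := by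
  by_contra hxr
  set B := {p ∈ Ico (0 : ℝ) 1 | ¬ RightCovered f S p}
  have hBfin : B.Finite := (H.finite_Icc_diff_coveredSet htrans ha hab hb hS).subset
    fun p hp => ⟨Ico_subset_Icc_self hp.1, fun h => hp.2 h.2.2⟩
  obtain ⟨ε, hε, hεab, hεB⟩ : ∃ ε > 0, ε < (b - a) / 2 ∧
      ∀ p ∈ B, ε < 1 - p ∧ (p < f 0 → ε < f 0 - p) := by
    have h1 : ∀ᶠ ε in 𝓝[>] (0 : ℝ), ∀ p ∈ B, ε < 1 - p ∧ (p < f 0 → ε < f 0 - p) := by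
      refine (eventually_all_finite hBfin).2 fun p hp => nhdsWithin_le_nhds ?_
      refine (eventually_lt_nhds (sub_pos.2 hp.1.2)).and ?_
      by_cases h : p < f 0
      · filter_upwards [eventually_lt_nhds (sub_pos.2 h)] with ε h' _ using h'
      · exact Eventually.of_forall fun _ h' => absurd h' h
    have h2 : ∀ᶠ ε in 𝓝[>] (0 : ℝ), ε < (b - a) / 2 :=
      nhdsWithin_le_nhds (eventually_lt_nhds (by linarith))
    obtain ⟨ε, h3, h4, h5⟩ := (h1.and (h2.and self_mem_nhdsWithin)).exists
    exact ⟨ε, h5, h4, h3⟩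
  have hI := Ioo_subset_coveredSet ha hb
    (hS.trans (by simpa using image_iterate_subset_reach f S 0))
  set V := ⋃ p ∈ B, Ioo p (p + ε)
  have hVne : (V ∩ Icc 0 1).Nonempty := by
    refine ⟨x + ε / 2, mem_iUnion₂.2 ⟨x, ⟨hx, hxr⟩, by constructor <;> linarith⟩, ?_⟩
    have := (hεB x ⟨hx, hxr⟩).1
    constructor <;> linarith [hx.1]
  have hVinv : ∀ y ∈ Icc (0 : ℝ) 1, f y ∈ V → y ∈ V := by
    intro y hy hyV
    obtain ⟨p, hp, hyp⟩ := mem_iUnion₂.1 hyV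
    obtain ⟨-, hεp⟩ := hεB p hp
    have hl := H.one_lt
    suffices h : ∃ y', 0 ≤ y' ∧ y' ≤ y ∧ f y' = p ∧ lam * (y - y') ≤ f y - p by
      obtain ⟨y', h1, h2, h3, h4⟩ := h
      have hlt : y' < y := lt_of_le_of_ne h2 fun h => hyp.1.ne (h ▸ h3).symm
      have h5 : y' < 1 := hlt.trans_le hy.2
      exact mem_iUnion₂.2 ⟨y', ⟨⟨h1, h5⟩, fun h => hp.2 (h3 ▸ H.rightCovered_map h1 h5 h)⟩, hlt,
        by nlinarith [hyp.2]⟩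
    rcases lt_or_ge y c with hyc | hyc
    · have hgy := H.eq_of_ne y hyc.ne
      have hg0 := H.eq_of_ne 0 H.pos.ne
      have hpf : f 0 ≤ p := by
        by_contra! h
        have h1 := H.exp_left 0 ⟨le_rfl, H.pos.le⟩ y ⟨hy.1, hyc.le⟩ hy.1
        rw [hgy, hg0] at h1
        nlinarith [hεp h, hyp.2, hy.1]
      obtain ⟨y', hy', hyp'⟩ := intermediate_value_Icc hy.1
        (H.cont_left.mono (Icc_subset_Icc_right hyc.le))
        (show p ∈ Icc (g 0) (g y) from ⟨hg0 ▸ hpf, hgy ▸ hyp.1.le⟩)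
      have hexp := H.exp_left y' ⟨hy'.1, hy'.2.trans hyc.le⟩ y ⟨hy.1, hyc.le⟩ hy'.2
      rw [hgy, hyp'] at hexp
      exact ⟨y', hy'.1, hy'.2, (H.eq_of_ne y' (hy'.2.trans_lt hyc).ne).symm.trans hyp', hexp⟩
    · obtain ⟨y', hy', hyp'⟩ := intermediate_value_Icc hyc
        (H.cont_right.mono (Icc_subset_Icc_right hy.2))
        (show p ∈ Icc (f c) (f y) from ⟨H.map_c ▸ hp.1.1, hyp.1.le⟩)
      have hexp := H.exp_right y' ⟨hy'.1, hy'.2.trans hy.2⟩ y ⟨hyc, hy.2⟩ hy'.2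
      rw [hyp'] at hexp
      exact ⟨y', H.pos.le.trans hy'.1, hy'.2, hyp', hexp⟩
  obtain ⟨y, hy, hyV⟩ := H.inter_Ioo_nonempty_of_backward_invariant htrans
    (isOpen_biUnion fun p _ => isOpen_Ioo) hVne hVinv
    (show 0 ≤ (a + b) / 2 by linarith) (show (a + b) / 2 < b by linarith) hb
  obtain ⟨p, hp, hyp⟩ := mem_iUnion₂.1 hyV
  refine hp.2 (hI ⟨?_, hyp.1.trans hy.2⟩).2.2
  linarith [hy.1, hyp.2]

theorem exists_Icc_subset_closure_reach (H : LorenzBranches f g c lam)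
    (htrans : LorenzTransitive f) {a b : ℝ} (ha : 0 ≤ a) (hab : a < b) (hb : b ≤ 1)
    (hS : Ioo a b ⊆ S) : ∃ k, Icc 0 1 ⊆ closure (reach f S k) := by
  refine isCompact_Icc.induction_on (p := fun T => ∃ k, T ⊆ closure (reach f S k))
    ⟨0, empty_subset _⟩ (fun s t hst ⟨k, hk⟩ => ⟨k, hst.trans hk⟩) ?_ ?_
  · rintro s t ⟨k, hk⟩ ⟨l, hl⟩
    exact ⟨max k l, union_subset
      (hk.trans (closure_mono (reach_mono f S (le_max_left k l))))
      (hl.trans (closure_mono (reach_mono f S (le_max_right k l))))⟩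
  · intro x hx
    have hleft : ∃ k, ∃ p < x, Icc 0 1 ∩ Ioc p x ⊆ closure (reach f S k) ∨ x = 0 := by
      rcases hx.1.eq_or_lt with h | h
      · exact ⟨0, x - 1, by linarith, Or.inr h.symm⟩
      · obtain ⟨k, p, hp, hsub⟩ := H.leftCovered htrans ha hab hb hS ⟨h, hx.2⟩
        refine ⟨k, p, hp, Or.inl (inter_subset_right.trans ?_)⟩
        refine Ioc_subset_Icc_self.trans ?_
        rw [← closure_Ioo hp.ne]
        exact closure_mono hsub
    have hright : ∃ k, ∃ q > x, Icc 0 1 ∩ Ico x q ⊆ closure (reach f S k) ∨ x = 1 := by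
      rcases hx.2.eq_or_lt with h | h
      · exact ⟨0, x + 1, by linarith, Or.inr h⟩
      · obtain ⟨k, q, hq, hsub⟩ := H.rightCovered htrans ha hab hb hS ⟨hx.1, h⟩
        refine ⟨k, q, hq, Or.inl (inter_subset_right.trans ?_)⟩
        refine Ico_subset_Icc_self.trans ?_
        rw [← closure_Ioo hq.lt.ne]
        exact closure_mono hsub
    obtain ⟨k, p, hp, hkp⟩ := hleft
    obtain ⟨l, q, hq, hlq⟩ := hright
    refine ⟨Icc 0 1 ∩ Ioo p q, inter_mem_nhdsWithin _ (Ioo_mem_nhds hp hq), max k l, ?_⟩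
    rintro y ⟨hy, hyp⟩
    have hmem : y ∈ closure (reach f S k) ∨ y ∈ closure (reach f S l) := by
      rcases hkp with hkp | hx0 <;> rcases hlq with hlq | hx1
      · rcases le_total y x with h | h
        · exact Or.inl (hkp ⟨hy, hyp.1, h⟩)
        · exact Or.inr (hlq ⟨hy, h, hyp.2⟩)
      · exact Or.inl (hkp ⟨hy, hyp.1, hx1 ▸ hy.2⟩)
      · exact Or.inr (hlq ⟨hy, hx0 ▸ hy.1, hyp.2⟩)
      · exact absurd (hx0.symm.trans hx1) zero_ne_one
    exact hmem.elim (fun h => closure_mono (reach_mono f S (le_max_left k l)) h)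
      (fun h => closure_mono (reach_mono f S (le_max_right k l)) h)

end LorenzBranches

/-- a transitive expanding Lorenz map is strongly transitive:
finitely many iterates of any nonempty open set cover `[0,1]` up to closures. -/
theorem strongly_transitive_of_transitive
    (f : ℝ → ℝ) (c : ℝ) (hf : IsExpandingLorenz f c) (hc : f c = 0)
    (htrans : LorenzTransitive f) :
    ∀ U : Set ℝ, IsOpen U → (U ∩ Set.Icc 0 1).Nonempty →
      ∃ k : ℕ, (⋃ i ∈ Set.Iic k, closure (f^[i] '' (U ∩ Set.Icc 0 1)))
        = Set.Icc (0:ℝ) 1 := by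
  intro U hU hne
  obtain ⟨lam, H⟩ := hf.exists_branches hc
  obtain ⟨a, b, ha, hab, hb, hS⟩ : ∃ a b : ℝ, 0 ≤ a ∧ a < b ∧ b ≤ 1 ∧ Ioo a b ⊆ U ∩ Icc 0 1 := by
    obtain ⟨x, hxU, hx⟩ := hne
    rw [← closure_Ioo (zero_ne_one' ℝ)] at hx
    obtain ⟨y, hyU, hy⟩ := mem_closure_iff.1 hx U hU hxU
    obtain ⟨a, b, hyab, hsub⟩ :=
      mem_nhds_iff_exists_Ioo_subset.1 ((hU.inter isOpen_Ioo).mem_nhds ⟨hyU, hy⟩)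
    have hab := hyab.1.trans hyab.2
    have h01 := (Ioo_subset_Ioo_iff hab).1 (hsub.trans inter_subset_right)
    exact ⟨a, b, h01.1, hab, h01.2, hsub.trans (inter_subset_inter_right U Ioo_subset_Icc_self)⟩
  obtain ⟨k, hk⟩ := H.exists_Icc_subset_closure_reach htrans ha hab hb hS
  refine ⟨k, Subset.antisymm ?_ ?_⟩
  · refine iUnion₂_subset fun i _ => closure_minimal ?_ isClosed_Icc
    exact ((H.mapsTo_iterate i).mono_left inter_subset_right).image_subset
  · rwa [reach, (finite_Iic k).closure_biUnion] at hk
end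

section
/- Let f be an expanding Lorenz map with critical point c which is locally eventually onto, and let g = (f^l, f^r) be a renormalization of f with renormalization interval [u,v]. Then F_g = [0,1]; that is, for every x ∈ [0,1] there exists n ≥ 0 with f^i(x) ≠ c for 0 ≤ i < n and f^n(x) ∈ (u,v). -/
open Set Filter Topology Function

/-- The order-theoretic and topological part of `IsExpandingLorenzOn`: a Lorenz map on `[a,b]`
with critical point `c`, with no expansion required. -/
structure IsLorenzOn (f : ℝ → ℝ) (c a b : ℝ) : Prop where
  a_lt_c : a < c
  c_lt_b : c < b
  mapsTo : MapsTo f (Icc a b) (Icc a b)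
  mono_left : StrictMonoOn f (Ico a c)
  mono_right : StrictMonoOn f (Ioc c b)
  cont_left : ContinuousOn f (Ico a c)
  cont_right : ContinuousOn f (Ioc c b)
  lim_left : Tendsto f (𝓝[<] c) (𝓝 b)
  lim_right : Tendsto f (𝓝[>] c) (𝓝 a)

/-- `g` is a Lorenz map on `[u,v] ⊆ [a,b]` which is given by `f^[l]` on `[u,c)` and by `f^[r]` on
`(c,v]` at every point whose relevant `f`-orbit segment avoids `c`. -/
structure IsReturnMap (f g : ℝ → ℝ) (c a b : ℝ) (l r : ℕ) (u v : ℝ) : Prop where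
  base : IsLorenzOn f c a b
  lorenz : IsLorenzOn g c u v
  one_lt_l : 1 < l
  one_lt_r : 1 < r
  le_u : a ≤ u
  v_le : v ≤ b
  eq_left : ∀ x ∈ Ico u c, (∀ i < l, f^[i] x ≠ c) → g x = f^[l] x
  eq_right : ∀ x ∈ Ioc c v, (∀ i < r, f^[i] x ≠ c) → g x = f^[r] x

theorem IsExpandingLorenzOn.isLorenzOn {f : ℝ → ℝ} {c a b : ℝ} (h : IsExpandingLorenzOn f c a b) :
    IsLorenzOn f c a b :=
  ⟨h.a_lt_c, h.c_lt_b, h.mapsTo, h.mono_left, h.mono_right, h.cont_left, h.cont_right,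
    h.lim_left, h.lim_right⟩

theorem IsRenormalization.isReturnMap {f g : ℝ → ℝ} {c u v : ℝ} {l r : ℕ}
    (hf : IsExpandingLorenz f c) (hg : IsRenormalization f c l r u v g) :
    IsReturnMap f g c 0 1 l r u v :=
  ⟨IsExpandingLorenzOn.isLorenzOn hf, hg.lorenz.isLorenzOn, hg.one_lt_l, hg.one_lt_r,
    hg.u_nonneg, hg.v_le_one, hg.eq_left, hg.eq_right⟩

theorem iterate_neg_conj (f : ℝ → ℝ) (n : ℕ) (x : ℝ) :
    (fun t => -f (-t))^[n] x = -f^[n] (-x) := by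
  induction n generalizing x with
  | zero => simp
  | succ n ih => simp [iterate_succ_apply, ih]

theorem tendsto_nhdsGT_of_strictMonoOn {f : ℝ → ℝ} {s : Set ℝ} {y : ℝ} (hm : StrictMonoOn f s)
    (hc : ContinuousOn f s) (hy : y ∈ s) (hs : s ∈ 𝓝[>] y) :
    Tendsto f (𝓝[>] y) (𝓝[>] (f y)) := by
  refine tendsto_nhdsWithin_iff.2 ⟨(hc y hy).mono_left (nhdsWithin_le_iff.2 hs), ?_⟩
  filter_upwards [hs, self_mem_nhdsWithin] with t ht hyt
  exact hm hy ht hyt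

theorem eq_of_tendsto_nhdsGT {f : ℝ → ℝ} {y z w : ℝ} (hz : Tendsto f (𝓝[>] y) (𝓝[>] z))
    (hw : Tendsto f (𝓝[>] y) (𝓝 w)) : z = w :=
  tendsto_nhds_unique (hz.mono_right nhdsWithin_le_nhds) hw

namespace IsLorenzOn

variable {f : ℝ → ℝ} {c a b : ℝ}

/-- Reflection through the origin preserves Lorenz maps. -/
theorem neg (h : IsLorenzOn f c a b) : IsLorenzOn (fun x => -f (-x)) (-c) (-b) (-a) where
  a_lt_c := neg_lt_neg h.c_lt_b
  c_lt_b := neg_lt_neg h.a_lt_c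
  mapsTo x hx := by
    have := h.mapsTo (x := -x) ⟨by linarith [hx.2], by linarith [hx.1]⟩
    exact ⟨by linarith [this.2], by linarith [this.1]⟩
  mono_left x hx y hy hxy := neg_lt_neg <|
    h.mono_right ⟨by linarith [hy.2], by linarith [hy.1]⟩ ⟨by linarith [hx.2], by linarith [hx.1]⟩
      (neg_lt_neg hxy)
  mono_right x hx y hy hxy := neg_lt_neg <|
    h.mono_left ⟨by linarith [hy.2], by linarith [hy.1]⟩ ⟨by linarith [hx.2], by linarith [hx.1]⟩
      (neg_lt_neg hxy)
  cont_left := (h.cont_right.comp continuousOn_neg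
    fun x hx => ⟨by linarith [hx.2], by linarith [hx.1]⟩).neg
  cont_right := (h.cont_left.comp continuousOn_neg
    fun x hx => ⟨by linarith [hx.2], by linarith [hx.1]⟩).neg
  lim_left := (h.lim_right.comp (by simpa using tendsto_neg_nhdsLT (a := -c))).neg
  lim_right := (h.lim_left.comp (by simpa using tendsto_neg_nhdsGT (a := -c))).neg

theorem tendsto_nhdsGT_crit (h : IsLorenzOn f c a b) : Tendsto f (𝓝[>] c) (𝓝[>] a) := by
  refine tendsto_nhdsWithin_iff.2 ⟨h.lim_right, ?_⟩
  filter_upwards [Ioc_mem_nhdsGT h.c_lt_b] with t ht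
  have hs : (c + t) / 2 ∈ Ioc c b := ⟨by linarith [ht.1], by linarith [ht.1, ht.2]⟩
  exact (h.mapsTo ⟨h.a_lt_c.le.trans hs.1.le, hs.2⟩).1.trans_lt
    (h.mono_right hs ht (by linarith [ht.1]))

theorem apply_lt (h : IsLorenzOn f c a b) {y : ℝ} (hy : y ∈ Ico a b) (hyc : y ≠ c) : f y < b := by
  rcases hyc.lt_or_gt with hyc | hyc
  · have hs : (y + c) / 2 ∈ Ico a c := ⟨by linarith [hy.1], by linarith⟩
    exact (h.mono_left ⟨hy.1, hyc⟩ hs (by linarith)).trans_le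
      (h.mapsTo ⟨hs.1, hs.2.le.trans h.c_lt_b.le⟩).2
  · exact (h.mono_right ⟨hyc, hy.2.le⟩ ⟨h.c_lt_b, le_rfl⟩ hy.2).trans_le
      (h.mapsTo ⟨h.a_lt_c.le.trans h.c_lt_b.le, le_rfl⟩).2

theorem apply_mem_Ico (h : IsLorenzOn f c a b) {y : ℝ} (hy : y ∈ Ico a b) (hyc : y ≠ c) :
    f y ∈ Ico a b :=
  ⟨(h.mapsTo ⟨hy.1, hy.2.le⟩).1, h.apply_lt hy hyc⟩

theorem apply_mem_Ioo (h : IsLorenzOn f c a b) {y : ℝ} (hy : y ∈ Ioo a b) (hyc : y ≠ c) :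
    f y ∈ Ioo a b := by
  have := h.neg.apply_lt (y := -y) ⟨by linarith [hy.2], by linarith [hy.1]⟩ (by simpa using hyc)
  rw [neg_neg] at this
  exact ⟨by linarith, h.apply_lt ⟨hy.1.le, hy.2⟩ hyc⟩

theorem tendsto_nhdsGT (h : IsLorenzOn f c a b) {y : ℝ} (hy : y ∈ Ico a b) (hyc : y ≠ c) :
    Tendsto f (𝓝[>] y) (𝓝[>] (f y)) := by
  rcases hyc.lt_or_gt with hyc | hyc
  · exact tendsto_nhdsGT_of_strictMonoOn h.mono_left h.cont_left ⟨hy.1, hyc⟩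
      (mem_of_superset (Ioo_mem_nhdsGT hyc) fun t ht => ⟨hy.1.trans ht.1.le, ht.2⟩)
  · exact tendsto_nhdsGT_of_strictMonoOn h.mono_right h.cont_right ⟨hyc, hy.2.le⟩
      (mem_of_superset (Ioo_mem_nhdsGT hy.2) fun t ht => ⟨hyc.trans ht.1, ht.2.le⟩)

theorem exists_tendsto_iterate (h : IsLorenzOn f c a b) (n : ℕ) {y : ℝ} (hy : y ∈ Ico a b) :
    ∃ z ∈ Ico a b, Tendsto f^[n] (𝓝[>] y) (𝓝[>] z) := by
  induction n with
  | zero => exact ⟨y, hy, tendsto_id⟩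
  | succ n ih =>
    obtain ⟨z, hz, ht⟩ := ih
    rw [iterate_succ']
    by_cases hzc : z = c
    · subst hzc
      exact ⟨a, ⟨le_rfl, h.a_lt_c.trans h.c_lt_b⟩, h.tendsto_nhdsGT_crit.comp ht⟩
    · exact ⟨f z, h.apply_mem_Ico hz hzc, (h.tendsto_nhdsGT hz hzc).comp ht⟩

theorem tendsto_iterate (h : IsLorenzOn f c a b) {n : ℕ} {y : ℝ} (hy : y ∈ Ico a b)
    (hfree : ∀ i < n, f^[i] y ≠ c) :
    f^[n] y ∈ Ico a b ∧ Tendsto f^[n] (𝓝[>] y) (𝓝[>] (f^[n] y)) := by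
  induction n with
  | zero => exact ⟨hy, tendsto_id⟩
  | succ n ih =>
    obtain ⟨hm, ht⟩ := ih fun i hi => hfree i (hi.trans n.lt_succ_self)
    have hc := hfree n n.lt_succ_self
    rw [iterate_succ_apply', iterate_succ']
    exact ⟨h.apply_mem_Ico hm hc, (h.tendsto_nhdsGT hm hc).comp ht⟩

theorem eventually_iterate_ne (h : IsLorenzOn f c a b) (n : ℕ) {y : ℝ} (hy : y ∈ Ico a b) :
    ∀ᶠ t in 𝓝[>] y, ∀ i < n, f^[i] t ≠ c := by
  refine (eventually_all_finite (finite_lt_nat n)).2 fun i _ => ?_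
  obtain ⟨z, -, ht⟩ := h.exists_tendsto_iterate i hy
  refine ht.eventually (p := (· ≠ c)) ?_
  by_cases hzc : z = c
  · subst hzc
    filter_upwards [self_mem_nhdsWithin] with t ht using ne_of_gt ht
  · exact nhdsWithin_le_nhds (eventually_ne_nhds hzc)

theorem exists_apply_eq_crit (h : IsLorenzOn f c a b) (ha : f a = a) : ∃ p ∈ Ioo a c, f p = c := by
  obtain ⟨q, hq, hqc⟩ := ((h.lim_left.eventually (lt_mem_nhds h.c_lt_b)).and
    (Ioo_mem_nhdsLT h.a_lt_c)).exists
  obtain ⟨p, hp, hpc⟩ := intermediate_value_Icc hqc.1.le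
    (h.cont_left.mono fun t ht => ⟨ht.1, ht.2.trans_lt hqc.2⟩)
    (show c ∈ Icc (f a) (f q) from ⟨ha.le.trans h.a_lt_c.le, hq.le⟩)
  refine ⟨p, ⟨hp.1.lt_of_ne ?_, hp.2.trans_lt hqc.2⟩, hpc⟩
  rintro rfl
  exact h.a_lt_c.ne (ha.symm.trans hpc)

end IsLorenzOn

namespace IsReturnMap

variable {f g : ℝ → ℝ} {c a b : ℝ} {l r : ℕ} {u v : ℝ}

/-- Reflection through the origin exchanges the two branches of a return map. -/
theorem neg (h : IsReturnMap f g c a b l r u v) :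
    IsReturnMap (fun x => -f (-x)) (fun x => -g (-x)) (-c) (-b) (-a) r l (-v) (-u) where
  base := h.base.neg
  lorenz := h.lorenz.neg
  one_lt_l := h.one_lt_r
  one_lt_r := h.one_lt_l
  le_u := neg_le_neg h.v_le
  v_le := neg_le_neg h.le_u
  eq_left x hx hfree := by
    rw [iterate_neg_conj, h.eq_right (-x) ⟨by linarith [hx.2], by linarith [hx.1]⟩]
    exact fun i hi => by simpa [iterate_neg_conj] using hfree i hi
  eq_right x hx hfree := by
    rw [iterate_neg_conj, h.eq_left (-x) ⟨by linarith [hx.2], by linarith [hx.1]⟩]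
    exact fun i hi => by simpa [iterate_neg_conj] using hfree i hi

theorem mem_Ico (h : IsReturnMap f g c a b l r u v) {y : ℝ} (hy : y ∈ Ico u v) : y ∈ Ico a b :=
  ⟨h.le_u.trans hy.1, hy.2.trans_le h.v_le⟩

theorem u_lt_v (h : IsReturnMap f g c a b l r u v) : u < v :=
  h.lorenz.a_lt_c.trans h.lorenz.c_lt_b

theorem tendsto_left (h : IsReturnMap f g c a b l r u v) {y : ℝ} (hy : y ∈ Ico u c) :
    Tendsto f^[l] (𝓝[>] y) (𝓝[>] (g y)) := by
  have hy' : y ∈ Ico u v := ⟨hy.1, hy.2.trans h.lorenz.c_lt_b⟩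
  refine (h.lorenz.tendsto_nhdsGT hy' hy.2.ne).congr' ?_
  filter_upwards [h.base.eventually_iterate_ne l (h.mem_Ico hy'), Ioo_mem_nhdsGT hy.2] with t ht hyt
  exact h.eq_left t ⟨hy.1.trans hyt.1.le, hyt.2⟩ ht

theorem tendsto_right (h : IsReturnMap f g c a b l r u v) {y : ℝ} (hy : y ∈ Ioo c v) :
    Tendsto f^[r] (𝓝[>] y) (𝓝[>] (g y)) := by
  have hy' : y ∈ Ico u v := ⟨h.lorenz.a_lt_c.le.trans hy.1.le, hy.2⟩
  refine (h.lorenz.tendsto_nhdsGT hy' hy.1.ne').congr' ?_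
  filter_upwards [h.base.eventually_iterate_ne r (h.mem_Ico hy'), Ioo_mem_nhdsGT hy.2] with t ht hyt
  exact h.eq_right t ⟨hy.1.trans hyt.1, hyt.2.le⟩ ht

theorem tendsto_crit (h : IsReturnMap f g c a b l r u v) :
    Tendsto f^[r] (𝓝[>] c) (𝓝[>] u) := by
  refine h.lorenz.tendsto_nhdsGT_crit.congr' ?_
  filter_upwards [h.base.eventually_iterate_ne r ⟨h.base.a_lt_c.le, h.base.c_lt_b⟩,
    Ioc_mem_nhdsGT h.lorenz.c_lt_b] with t ht hct
  exact h.eq_right t hct ht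

theorem exists_tendsto_return (h : IsReturnMap f g c a b l r u v) {y : ℝ} (hy : y ∈ Ico u v) :
    ∃ k, 1 ≤ k ∧ ∃ z ∈ Ico u v, Tendsto f^[k] (𝓝[>] y) (𝓝[>] z) := by
  rcases lt_trichotomy y c with hyc | rfl | hyc
  · exact ⟨l, h.one_lt_l.le, _, h.lorenz.apply_mem_Ico hy hyc.ne, h.tendsto_left ⟨hy.1, hyc⟩⟩
  · exact ⟨r, h.one_lt_r.le, u, ⟨le_rfl, h.u_lt_v⟩, h.tendsto_crit⟩
  · exact ⟨r, h.one_lt_r.le, _, h.lorenz.apply_mem_Ico hy hyc.ne', h.tendsto_right ⟨hyc, hy.2⟩⟩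

theorem exists_ge_tendsto_return (h : IsReturnMap f g c a b l r u v) {y : ℝ} (hy : y ∈ Ico u v)
    (m : ℕ) : ∃ j, m ≤ j ∧ ∃ z ∈ Ico u v, Tendsto f^[j] (𝓝[>] y) (𝓝[>] z) := by
  induction m with
  | zero => exact ⟨0, le_rfl, y, hy, tendsto_id⟩
  | succ m ih =>
    obtain ⟨j, hj, z, hz, ht⟩ := ih
    obtain ⟨k, hk, w, hw, ht'⟩ := h.exists_tendsto_return hz
    exact ⟨k + j, by omega, w, hw, by rw [iterate_add]; exact ht'.comp ht⟩

theorem crit_mem (h : IsReturnMap f g c a b l r u v) : c ∈ Ioo u v :=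
  ⟨h.lorenz.a_lt_c, h.lorenz.c_lt_b⟩

/-- If some iterate of `f` sends the right germ at a point of `[u,v)` to a point whose orbit
avoids `(u,v)`, then the right germ at `u` is fixed by `f^[l]`. -/
theorem tendsto_u_of_avoid (h : IsReturnMap f g c a b l r u v) {x y : ℝ} {n : ℕ}
    (hy : y ∈ Ico u v) (hx : ∀ m, f^[m] x ∉ Ioo u v) (hn : Tendsto f^[n] (𝓝[>] y) (𝓝 x)) :
    Tendsto f^[l] (𝓝[>] u) (𝓝[>] u) := by
  obtain ⟨j, hj, z, hz, ht⟩ := h.exists_ge_tendsto_return hy n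
  obtain ⟨x', hx', htx⟩ := h.base.exists_tendsto_iterate n (h.mem_Ico hy)
  obtain rfl : x' = x := eq_of_tendsto_nhdsGT htx hn
  have free : ∀ i, f^[i] x' ≠ c := fun i hi => hx i (hi ▸ h.crit_mem)
  have ht' := (h.base.tendsto_iterate (n := j - n) hx' fun i _ => free i).2.comp htx
  rw [← iterate_add, Nat.sub_add_cancel hj] at ht'
  have hzx := eq_of_tendsto_nhdsGT ht (ht'.mono_right nhdsWithin_le_nhds)
  have hzu : f^[j - n] x' = u := by
    by_contra hne
    exact hx (j - n) ⟨lt_of_le_of_ne (hzx ▸ hz.1) (Ne.symm hne), hzx ▸ hz.2⟩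
  have hu : ∀ m, f^[m] u ∉ Ioo u v := fun m => by
    rw [← hzu, ← iterate_add_apply, hzu]; exact hx _
  have hmem : u ∈ Ico u c := ⟨le_rfl, h.lorenz.a_lt_c⟩
  have hgu := h.eq_left u hmem fun i _ hi => hu i (hi ▸ h.crit_mem)
  have hgm := h.lorenz.apply_mem_Ico ⟨le_rfl, h.u_lt_v⟩ h.lorenz.a_lt_c.ne
  have hfix : g u = u := by
    by_contra hne
    exact hu l (hgu ▸ ⟨lt_of_le_of_ne hgm.1 (Ne.symm hne), hgm.2⟩)
  simpa only [hfix] using h.tendsto_left hmem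

/-- If `f^[n]` sends the right germ at `y` to a point `x` whose orbit avoids `(u,v)`, and `y` hits
the critical point at time `i`, then the orbit of `x` follows the right germ of `c` to `u`. -/
theorem iterate_eq_u (h : IsReturnMap f g c a b l r u v) {x y : ℝ} {n i : ℕ}
    (hy : y ∈ Ico u v) (hx : ∀ m, f^[m] x ∉ Ioo u v) (hn : Tendsto f^[n] (𝓝[>] y) (𝓝 x))
    (hfree : ∀ j < i, f^[j] y ≠ c) (hi : f^[i] y = c) (k : ℕ)
    (hk : n ≤ l * k + r + i) : f^[l * k + r + i - n] x = u := by
  have h1 := (h.base.tendsto_iterate (h.mem_Ico hy) hfree).2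
  rw [hi] at h1
  have h2 := (h.tendsto_u_of_avoid hy hx hn).iterate k
  rw [← iterate_mul] at h2
  have h3 := (h2.comp h.tendsto_crit).comp h1
  rw [← iterate_add, ← iterate_add] at h3
  obtain ⟨x', hx', htx⟩ := h.base.exists_tendsto_iterate n (h.mem_Ico hy)
  obtain rfl : x' = x := eq_of_tendsto_nhdsGT htx hn
  have h4 := (h.base.tendsto_iterate (n := l * k + r + i - n) hx'
    fun j _ hj => hx j (hj ▸ h.crit_mem)).2.comp htx
  rw [← iterate_add, Nat.sub_add_cancel hk] at h4
  exact eq_of_tendsto_nhdsGT h4 (h3.mono_right nhdsWithin_le_nhds)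

theorem apply_a_ne (h : IsReturnMap f g c a b l r u v) : f a ≠ a := by
  intro ha
  have haa : Tendsto f (𝓝[>] a) (𝓝[>] a) := by
    simpa only [ha] using h.base.tendsto_nhdsGT ⟨le_rfl, h.base.a_lt_c.trans h.base.c_lt_b⟩
      h.base.a_lt_c.ne
  have hcr : Tendsto f^[r] (𝓝[>] c) (𝓝[>] a) := by
    have := (haa.iterate (r - 1)).comp h.base.tendsto_nhdsGT_crit
    rwa [← iterate_succ, Nat.succ_eq_add_one, Nat.sub_add_cancel h.one_lt_r.le] at this
  obtain rfl : u = a := eq_of_tendsto_nhdsGT h.tendsto_crit (hcr.mono_right nhdsWithin_le_nhds)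
  obtain ⟨p, hp, hpc⟩ := h.base.exists_apply_eq_crit ha
  have hpm : p ∈ Ico u b := ⟨hp.1.le, hp.2.trans h.base.c_lt_b⟩
  have h1 := h.base.tendsto_nhdsGT hpm hp.2.ne
  rw [hpc] at h1
  have h2 := ((haa.iterate (l - 2)).comp h.base.tendsto_nhdsGT_crit).comp h1
  rw [← iterate_succ, ← iterate_succ, show (l - 2).succ.succ = l by have := h.one_lt_l; omega] at h2
  have h3 := eq_of_tendsto_nhdsGT (h.tendsto_left ⟨hp.1.le, hp.2⟩)
    (h2.mono_right nhdsWithin_le_nhds)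
  exact (h.lorenz.apply_mem_Ioo ⟨hp.1, hp.2.trans h.lorenz.c_lt_b⟩ hp.2.ne).1.ne' h3

theorem apply_b_ne (h : IsReturnMap f g c a b l r u v) : f b ≠ b := fun hb =>
  h.neg.apply_a_ne (by simp [hb])

theorem iterate_eq_v (h : IsReturnMap f g c a b l r u v) {x y : ℝ} {n i : ℕ}
    (hy : y ∈ Ioc u v) (hx : ∀ m, f^[m] x ∉ Ioo u v) (hn : Tendsto f^[n] (𝓝[<] y) (𝓝 x))
    (hfree : ∀ j < i, f^[j] y ≠ c) (hi : f^[i] y = c) (k : ℕ)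
    (hk : n ≤ r * k + l + i) : f^[r * k + l + i - n] x = v := by
  have hconj : ∀ m, (fun t => -f (-t))^[m] = fun t => -f^[m] (-t) :=
    fun m => funext (iterate_neg_conj f m)
  have key := h.neg.iterate_eq_u (x := -x) (y := -y) (n := n) (i := i)
    ⟨neg_le_neg hy.2, neg_lt_neg hy.1⟩
    (fun m hm => hx m (by
      rw [iterate_neg_conj, neg_neg] at hm
      exact ⟨neg_lt_neg_iff.1 hm.2, neg_lt_neg_iff.1 hm.1⟩))
    (by
      rw [hconj]
      exact (hn.comp (by simpa using tendsto_neg_nhdsGT (a := -y))).neg)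
    (fun j hj => by simpa [iterate_neg_conj] using hfree j hj)
    (by simp [iterate_neg_conj, hi]) k hk
  simpa [iterate_neg_conj] using key

theorem exists_return (h : IsReturnMap f g c a b l r u v) {y : ℝ} (hy : y ∈ Ioo u v)
    (hfree : ∀ i, f^[i] y ≠ c) : ∃ k, 1 ≤ k ∧ f^[k] y ∈ Ioo u v := by
  have hgy := h.lorenz.apply_mem_Ioo hy (hfree 0)
  rcases (show y ≠ c from hfree 0).lt_or_gt with hyc | hyc
  · exact ⟨l, h.one_lt_l.le, h.eq_left y ⟨hy.1.le, hyc⟩ (fun i _ => hfree i) ▸ hgy⟩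
  · exact ⟨r, h.one_lt_r.le, h.eq_right y ⟨hyc, hy.2.le⟩ (fun i _ => hfree i) ▸ hgy⟩

theorem exists_ge_return (h : IsReturnMap f g c a b l r u v) {y : ℝ} (hy : y ∈ Ioo u v)
    (hfree : ∀ i, f^[i] y ≠ c) (m : ℕ) : ∃ j, m ≤ j ∧ f^[j] y ∈ Ioo u v := by
  induction m with
  | zero => exact ⟨0, le_rfl, hy⟩
  | succ m ih =>
    obtain ⟨j, hj, hm⟩ := ih
    obtain ⟨k, hk, hm'⟩ := h.exists_return hm fun i => by
      rw [← iterate_add_apply]; exact hfree _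
    exact ⟨k + j, by omega, by rwa [iterate_add_apply]⟩

/-- A point whose orbit avoids `(u,v)` is not the image of a point of `(u,v)` under an iterate
that is continuous there, even if the orbit segment passes through the critical point. -/
theorem iterate_ne_of_avoid (h : IsReturnMap f g c a b l r u v) {x y : ℝ} {n : ℕ}
    (hy : y ∈ Ioo u v) (hx : ∀ m, f^[m] x ∉ Ioo u v) (hc : ContinuousAt f^[n] y) :
    f^[n] y ≠ x := by
  classical
  intro hyx
  by_cases hex : ∃ i, f^[i] y = c
  · have hfree : ∀ j < Nat.find hex, f^[j] y ≠ c := fun j => Nat.find_min hex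
    have hi := Nat.find_spec hex
    generalize Nat.find hex = i at hfree hi
    have hR : Tendsto f^[n] (𝓝[>] y) (𝓝 x) := hyx ▸ hc.tendsto.mono_left nhdsWithin_le_nhds
    have hL : Tendsto f^[n] (𝓝[<] y) (𝓝 x) := hyx ▸ hc.tendsto.mono_left nhdsWithin_le_nhds
    have hu := h.iterate_eq_u ⟨hy.1.le, hy.2⟩ hx hR hfree hi (1 + r * n)
      (by nlinarith [mul_pos (pos_of_gt h.one_lt_l) (pos_of_gt h.one_lt_r)])
    have hv := h.iterate_eq_v ⟨hy.1, hy.2.le⟩ hx hL hfree hi (1 + l * n)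
      (by nlinarith [mul_pos (pos_of_gt h.one_lt_l) (pos_of_gt h.one_lt_r)])
    rw [show r * (1 + l * n) + l + i = l * (1 + r * n) + r + i by ring] at hv
    exact h.u_lt_v.ne (hu.symm.trans hv)
  · push Not at hex
    obtain ⟨j, hj, hm⟩ := h.exists_ge_return hy hex n
    apply hx (j - n)
    rwa [← hyx, ← iterate_add_apply, Nat.sub_add_cancel hj]

end IsReturnMap

/-- if a locally eventually onto expanding Lorenz map has a
renormalization on `[u,v]`, then `F_g = [0,1]`. -/
theorem Fg_eq_unit_interval_of_leo
    (f g : ℝ → ℝ) (c u v : ℝ) (l r : ℕ)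
    (hf : IsExpandingLorenz f c) (hleo : LocallyEventuallyOnto f c)
    (hg : IsRenormalization f c l r u v g) :
    ∀ x ∈ Set.Icc (0:ℝ) 1, ∃ m : ℕ, (∀ i < m, f^[i] x ≠ c) ∧ f^[m] x ∈ Set.Ioo u v := by
  classical
  have h := hg.isReturnMap hf
  have key : ∀ x ∈ Ioo (0 : ℝ) 1, ∃ m, f^[m] x ∈ Ioo u v := by
    intro x hx
    by_contra! hav
    have hxc : x ≠ c := fun hxc => hav 0 (hxc ▸ h.crit_mem)
    obtain ⟨⟨p, q, -, hsub, n, hcont, -, himg⟩, ⟨p', q', -, hsub', n', hcont', -, himg'⟩⟩ :=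
      hleo (Ioo u v) isOpen_Ioo
        ⟨c, h.crit_mem, h.base.a_lt_c.le, h.base.c_lt_b.le⟩
    rcases hxc.lt_or_gt with hxc | hxc
    · obtain ⟨y, hy, hyx⟩ := himg.symm ▸ (show x ∈ Ioo 0 c from ⟨hx.1, hxc⟩)
      exact h.iterate_ne_of_avoid (hsub hy).1 hav (hcont.continuousAt (Ioo_mem_nhds hy.1 hy.2)) hyx
    · obtain ⟨y, hy, hyx⟩ := himg'.symm ▸ (show x ∈ Ioo c 1 from ⟨hxc, hx.2⟩)
      exact h.iterate_ne_of_avoid (hsub' hy).1 hav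
        (hcont'.continuousAt (Ioo_mem_nhds hy.1 hy.2)) hyx
  have hall : ∀ x ∈ Icc (0 : ℝ) 1, ∃ m, f^[m] x ∈ Ioo u v := by
    intro x hx
    rcases hx.1.eq_or_lt with rfl | h0
    · have := h.base.apply_mem_Ico ⟨le_rfl, zero_lt_one⟩ h.base.a_lt_c.ne
      obtain ⟨m, hm⟩ := key (f 0) ⟨this.1.lt_of_ne h.apply_a_ne.symm, this.2⟩
      exact ⟨m + 1, hm⟩
    rcases hx.2.eq_or_lt with rfl | h1
    · have := h.base.neg.apply_mem_Ico (y := -1) ⟨le_rfl, by norm_num⟩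
        (neg_lt_neg h.base.c_lt_b).ne
      rw [neg_neg] at this
      obtain ⟨m, hm⟩ := key (f 1)
        ⟨by linarith [this.2], (by linarith [this.1] : f 1 ≤ 1).lt_of_ne h.apply_b_ne⟩
      exact ⟨m + 1, hm⟩
    · exact key x ⟨h0, h1⟩
  intro x hx
  have hex := hall x hx
  exact ⟨Nat.find hex, fun i hi hic => Nat.find_min hex hi (hic ▸ h.crit_mem), Nat.find_spec hex⟩
end

section
/- Let f be an expanding Lorenz map with critical point c admitting a primary n(k)-cycle, and adopt the convention f(c) = 0. For x ∈ [0,1] and N ∈ ℕ put m_N(x) = #{0 ≤ i < N : f^i(x) ≥ c}. Then for every x ∈ [0,1] the rotation number ρ(x) = lim_{N→∞} m_N(x)/N exists and equals k/n; in particular the rotation interval of f degenerates to the single point {k/n}. -/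
open Set Filter Topology Function

/-- `x` lies in the `m`-th of the `n + 1` closed cells cut out by `z 0 < ⋯ < z (n - 1)`. -/
structure InCell (n : ℕ) (z : ℕ → ℝ) (x : ℝ) (m : ℕ) : Prop where
  le : m ≤ n
  lower : ∀ j < m, z j ≤ x
  upper : ∀ j, m ≤ j → j < n → x ≤ z j

theorem exists_inCell {n : ℕ} {z : ℕ → ℝ} (hz : ∀ i j : ℕ, i < j → j < n → z i < z j) (x : ℝ) :
    ∃ m, InCell n z x m := by
  classical
  have h : ∃ m, m = n ∨ x ≤ z m := ⟨n, Or.inl rfl⟩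
  have hle : Nat.find h ≤ n := Nat.find_min' h (Or.inl rfl)
  refine ⟨Nat.find h, hle, fun j hj => ?_, fun j hj hjn => ?_⟩
  · have := Nat.find_min h hj
    push Not at this
    exact this.2.le
  · rcases Nat.find_spec h with h' | h'
    · omega
    · rcases hj.eq_or_lt with e | e
      · rwa [← e]
      · exact h'.trans (hz _ _ e hjn).le

/-- Left of the critical point, a map with a primary `n(k)`-cycle moves cells up by `k`. -/
theorem InCell.map_of_lt {f : ℝ → ℝ} {c : ℝ} {n k : ℕ} {z : ℕ → ℝ} {x : ℝ} {m : ℕ}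
    (hf : IsExpandingLorenz f c) (hz : IsPrimaryCycle f c n k z)
    (hx : x ∈ Icc (0 : ℝ) 1) (hm : InCell n z x m) (hxc : x < c) :
    InCell n z (f x) (m + k) := by
  have hk := hz.k_pos
  have hkn := hz.k_lt_n
  have hf_mono := hf.mono_left.monotoneOn
  have hmk : m + k ≤ n := by
    by_contra! h
    have h₁ := hz.right_of_c (n - k) le_rfl (by omega)
    have h₂ := hm.lower (n - k) (by omega)
    linarith
  have hstep : ∀ i, i + k < n → f (z i) = z (i + k) := fun i hi => by
    rw [hz.step i (by omega), Nat.mod_eq_of_lt hi]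
  refine ⟨hmk, fun j hj => ?_, fun j hj hjn => ?_⟩
  · rcases lt_or_ge j k with hjk | hjk
    · have h₁ : z j ≤ z (k - 1) := by
        rcases (Nat.le_sub_one_of_lt hjk).eq_or_lt with e | e
        · rw [e]
        · exact (hz.mono _ _ e (by omega)).le
      exact h₁.trans (hz.le_f0.trans (hf_mono ⟨le_rfl, hf.a_lt_c⟩ ⟨hx.1, hxc⟩ hx.1))
    · have h₁ := hm.lower (j - k) (by omega)
      have h₂ := hf_mono ⟨(hz.mem (j - k) (by omega)).1, h₁.trans_lt hxc⟩ ⟨hx.1, hxc⟩ h₁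
      rwa [hstep _ (by omega), Nat.sub_add_cancel hjk] at h₂
  · have h₂ := hf_mono ⟨hx.1, hxc⟩
      ⟨(hz.mem (j - k) (by omega)).1, hz.left_of_c (j - k) (by omega)⟩
      (hm.upper (j - k) (by omega) (by omega))
    rwa [hstep _ (by omega), Nat.sub_add_cancel (by omega)] at h₂

/-- Right of the critical point, a map with a primary `n(k)`-cycle moves cells down by `n - k`. -/
theorem InCell.map_of_ge {f : ℝ → ℝ} {c : ℝ} {n k : ℕ} {z : ℕ → ℝ} {x : ℝ} {m : ℕ}
    (hf : IsExpandingLorenz f c) (hz : IsPrimaryCycle f c n k z) (hc : f c = 0)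
    (hx : x ∈ Icc (0 : ℝ) 1) (hm : InCell n z x m) (hcx : c ≤ x) :
    ∃ m', m' + n = m + k ∧ InCell n z (f x) m' := by
  have hk := hz.k_pos
  have hkn := hz.k_lt_n
  have hf_mono := hf.mono_right.monotoneOn
  have hmn := hm.le
  have hmk : n ≤ m + k := by
    by_contra! h
    have h₁ := hz.left_of_c m (by omega)
    have h₂ := hm.upper m le_rfl (by omega)
    linarith
  have hstep : ∀ j, j < k → f (z (j + (n - k))) = z j := fun j hj => by
    rw [hz.step _ (by omega), show j + (n - k) + k = j + n by omega, Nat.add_mod_right,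
      Nat.mod_eq_of_lt (by omega)]
  refine ⟨m + k - n, by omega, by omega, fun j hj => ?_, fun j hj hjn => ?_⟩
  · have h₀ := hz.right_of_c (j + (n - k)) (by omega) (by omega)
    have h₁ := hm.lower (j + (n - k)) (by omega)
    have h₂ := hf_mono ⟨h₀, (hz.mem _ (by omega)).2⟩ ⟨h₀.trans_le h₁, hx.2⟩ h₁
    rwa [hstep j (by omega)] at h₂
  · rcases hcx.eq_or_lt with rfl | hcx
    · rw [hc]
      exact (hz.mem j hjn).1
    rcases lt_or_ge j k with hjk | hjk
    · have h₂ := hf_mono ⟨hcx, hx.2⟩ ⟨hz.right_of_c (j + (n - k)) (by omega) (by omega),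
        (hz.mem _ (by omega)).2⟩ (hm.upper (j + (n - k)) (by omega) (by omega))
      rwa [hstep j hjk] at h₂
    · have h₁ : z k ≤ z j := by
        rcases hjk.eq_or_lt with e | e
        · rw [e]
        · exact (hz.mono _ _ e hjn).le
      exact ((hf_mono ⟨hcx, hx.2⟩ ⟨hf.c_lt_b, le_rfl⟩ hx.2).trans hz.f1_le).trans h₁

theorem ncard_lt_succ_and (p : ℕ → Prop) [DecidablePred p] (N : ℕ) :
    {i : ℕ | i < N + 1 ∧ p i}.ncard = {i : ℕ | i < N ∧ p i}.ncard + if p N then 1 else 0 := by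
  have h : ∀ M, {i : ℕ | i < M ∧ p i}.ncard = Nat.count p M := fun M => by
    rw [Nat.count_eq_card_filter_range, ← Set.ncard_coe_finset]
    congr 1
    ext i
    simp
  rw [h, h, Nat.count_succ]

/-- The cell of the `N`-th iterate determines the number of visits to `[c, 1]` before time `N`. -/
theorem InCell.iterate {f : ℝ → ℝ} {c : ℝ} {n k : ℕ} {z : ℕ → ℝ} {x : ℝ} {m : ℕ}
    (hf : IsExpandingLorenz f c) (hz : IsPrimaryCycle f c n k z) (hc : f c = 0)
    (hx : x ∈ Icc (0 : ℝ) 1) (hm : InCell n z x m) (N : ℕ) :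
    ∃ m', InCell n z (f^[N] x) m' ∧
      m' + n * {i : ℕ | i < N ∧ c ≤ f^[i] x}.ncard = m + k * N := by
  classical
  induction N with
  | zero => exact ⟨m, hm, by simp⟩
  | succ N ih =>
    obtain ⟨p, hp, he⟩ := ih
    have hxN : f^[N] x ∈ Icc (0 : ℝ) 1 := hf.mapsTo.iterate N hx
    rw [iterate_succ_apply', ncard_lt_succ_and (fun i => c ≤ f^[i] x)]
    rcases lt_or_ge (f^[N] x) c with h | h
    · refine ⟨p + k, hp.map_of_lt hf hz hxN h, ?_⟩
      rw [if_neg h.not_ge]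
      linarith
    · obtain ⟨q, hq, hq'⟩ := hp.map_of_ge hf hz hc hxN h
      refine ⟨q, hq', ?_⟩
      rw [if_pos h]
      linarith

/-- an expanding Lorenz map with a primary `n(k)`-cycle has rotation
number `k/n` at every point; the rotation interval is `{k/n}`. -/
theorem rotation_number_of_primary_cycle
    (f : ℝ → ℝ) (c : ℝ) (n k : ℕ) (z : ℕ → ℝ)
    (hf : IsExpandingLorenz f c) (hz : IsPrimaryCycle f c n k z) (hc : f c = 0) :
    ∀ x ∈ Set.Icc (0:ℝ) 1,
      Filter.Tendsto (fun N : ℕ => (({i : ℕ | i < N ∧ c ≤ f^[i] x}.ncard : ℝ)) / N)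
        Filter.atTop (nhds ((k : ℝ) / n)) := by
  intro x hx
  obtain ⟨m, hm⟩ := exists_inCell hz.mono x
  have hn : (0 : ℝ) < n := by exact_mod_cast hz.k_pos.trans hz.k_lt_n
  rw [tendsto_iff_dist_tendsto_zero]
  refine squeeze_zero' (.of_forall fun _ => dist_nonneg) ?_ tendsto_one_div_atTop_nhds_zero_nat
  filter_upwards [eventually_gt_atTop 0] with N hN
  have hN' : (0 : ℝ) < N := by exact_mod_cast hN
  obtain ⟨p, hp, he⟩ := hm.iterate hf hz hc hx N
  set C := {i : ℕ | i < N ∧ c ≤ f^[i] x}.ncard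
  have he' : (p : ℝ) + n * C = m + k * N := by exact_mod_cast he
  have hp' : (p : ℝ) ≤ n := by exact_mod_cast hp.le
  have hm' : (m : ℝ) ≤ n := by exact_mod_cast hm.le
  have hp₀ : (0 : ℝ) ≤ p := p.cast_nonneg
  have hm₀ : (0 : ℝ) ≤ m := m.cast_nonneg
  have hdiff : (C : ℝ) / N - k / n = (m - p) / n / N := by
    field_simp
    linarith
  rw [Real.dist_eq, hdiff, abs_div, abs_of_pos hN']
  gcongr
  rw [abs_div, abs_of_pos hn, div_le_one hn, abs_le]
  constructor <;> linarith
end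

section
/- Let f be an expanding Lorenz map with critical point c admitting a primary n(k)-cycle O = {z_0, …, z_{n-1}} with z_0 < ⋯ < z_{n-k-1} < c < z_{n-k} < ⋯ < z_{n-1}. Then z_0 > 0 and z_{n-1} < 1, and the set D defined as the closure in [0,1] of {x ∈ [0,1] : ∃i ≥ 0 with f^j(x) ≠ c for 0 ≤ j < i and f^i(x) ∈ O} satisfies: D = O if and only if z_{k-1} ≠ f(0) and z_k ≠ f(1). -/
open Set Filter Topology Function

namespace IsExpandingLorenzOn

variable {f : ℝ → ℝ} {c a b : ℝ}

/-- An expanding Lorenz map stays strictly below its left limit at `c` on the left branch. -/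
theorem lt_right_endpoint (hf : IsExpandingLorenzOn f c a b) {x : ℝ} (hx : x ∈ Ico a c) :
    f x < b := by
  obtain ⟨y, hxy, hyc⟩ := exists_between hx.2
  have hy : y ∈ Ico a c := ⟨hx.1.trans hxy.le, hyc⟩
  refine (hf.mono_left hx hy hxy).trans_le (ge_of_tendsto hf.lim_left ?_)
  filter_upwards [Ioo_mem_nhdsLT hyc] with w hw
  exact (hf.mono_left hy ⟨hy.1.trans hw.1.le, hw.2⟩ hw.1).le

/-- An expanding Lorenz map stays strictly above its right limit at `c` on the right branch. -/
theorem left_endpoint_lt (hf : IsExpandingLorenzOn f c a b) {x : ℝ} (hx : x ∈ Ioc c b) :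
    a < f x := by
  obtain ⟨y, hcy, hyx⟩ := exists_between hx.1
  have hy : y ∈ Ioc c b := ⟨hcy, hyx.le.trans hx.2⟩
  refine (le_of_tendsto hf.lim_right ?_).trans_lt (hf.mono_right hy hx hyx)
  filter_upwards [Ioo_mem_nhdsGT hcy] with w hw
  exact (hf.mono_right ⟨hw.1, hw.2.le.trans hy.2⟩ hy hw.2).le

end IsExpandingLorenzOn

namespace IsPrimaryCycle

variable {f : ℝ → ℝ} {c : ℝ} {n k : ℕ} {z : ℕ → ℝ}

theorem le_of_le (hz : IsPrimaryCycle f c n k z) {i j : ℕ} (hij : i ≤ j) (hj : j < n) :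
    z i ≤ z j := by
  rcases hij.eq_or_lt with rfl | h
  · exact le_rfl
  · exact (hz.mono i j h hj).le

theorem map_left (hz : IsPrimaryCycle f c n k z) {m : ℕ} (hk : k ≤ m) (hm : m < n) :
    f (z (m - k)) = z m := by
  rw [hz.step _ (by omega), Nat.sub_add_cancel hk, Nat.mod_eq_of_lt hm]

theorem map_right (hz : IsPrimaryCycle f c n k z) {m : ℕ} (hm : m < k) :
    f (z (m + (n - k))) = z m := by
  have hkn := hz.k_lt_n
  rw [hz.step _ (by omega), show m + (n - k) + k = m + n by omega, Nat.add_mod_right,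
    Nat.mod_eq_of_lt (hm.trans hkn)]

theorem zero_lt (hf : IsExpandingLorenz f c) (hz : IsPrimaryCycle f c n k z) : 0 < z 0 := by
  have hkn := hz.k_lt_n
  have hk := hz.k_pos
  rw [← hz.map_right hk]
  exact hf.left_endpoint_lt ⟨hz.right_of_c _ (by omega) (by omega), (hz.mem _ (by omega)).2⟩

theorem last_lt_one (hf : IsExpandingLorenz f c) (hz : IsPrimaryCycle f c n k z) :
    z (n - 1) < 1 := by
  have hkn := hz.k_lt_n
  have hk := hz.k_pos
  rw [← hz.map_left (show k ≤ n - 1 by omega) (by omega)]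
  exact hf.lt_right_endpoint ⟨(hz.mem _ (by omega)).1, hz.left_of_c _ (by omega)⟩

/-- If neither `f 0` nor `f 1` lies on a primary cycle, the only preimages of the cycle
other than `c` are its own points. -/
theorem exists_eq_of_map_eq (hf : IsExpandingLorenz f c) (hz : IsPrimaryCycle f c n k z)
    (h0 : z (k - 1) ≠ f 0) (h1 : z k ≠ f 1) {x : ℝ} (hx : x ∈ Icc (0 : ℝ) 1) (hxc : x ≠ c)
    {m : ℕ} (hm : m < n) (hxm : f x = z m) : ∃ l < n, x = z l := by
  have hkn := hz.k_lt_n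
  have hk := hz.k_pos
  rcases hxc.lt_or_gt with h | h
  · have hx' : x ∈ Ico 0 c := ⟨hx.1, h⟩
    have h0x : f 0 ≤ f x := hf.mono_left.monotoneOn ⟨le_rfl, hf.a_lt_c⟩ hx' hx.1
    have hkm : k ≤ m := by
      by_contra! hlt
      have h2 := hz.le_of_le (show m ≤ k - 1 by omega) (by omega)
      exact h0 (le_antisymm hz.le_f0 (by linarith))
    refine ⟨m - k, by omega, hf.mono_left.injOn hx' ?_ ?_⟩
    · exact ⟨(hz.mem _ (by omega)).1, hz.left_of_c _ (by omega)⟩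
    · rw [hxm, hz.map_left hkm hm]
  · have hx' : x ∈ Ioc c 1 := ⟨h, hx.2⟩
    have h1x : f x ≤ f 1 := hf.mono_right.monotoneOn hx' ⟨hf.c_lt_b, le_rfl⟩ hx.2
    have hmk : m < k := by
      by_contra! hle
      have h2 := hz.le_of_le hle hm
      exact h1 (le_antisymm (by linarith) hz.f1_le)
    refine ⟨m + (n - k), by omega, hf.mono_right.injOn hx' ?_ ?_⟩
    · exact ⟨hz.right_of_c _ (by omega) (by omega), (hz.mem _ (by omega)).2⟩
    · rw [hxm, hz.map_right hmk]

theorem exists_eq_of_iterate_eq (hf : IsExpandingLorenz f c) (hz : IsPrimaryCycle f c n k z)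
    (h0 : z (k - 1) ≠ f 0) (h1 : z k ≠ f 1) {i : ℕ} {x : ℝ} (hx : x ∈ Icc (0 : ℝ) 1)
    (hxc : ∀ j < i, f^[j] x ≠ c) (hi : ∃ m < n, f^[i] x = z m) : ∃ l < n, x = z l := by
  induction i generalizing x with
  | zero => exact hi
  | succ i ih =>
    obtain ⟨m, hm, hfm⟩ := ih (hf.mapsTo hx) (fun j hj => hxc (j + 1) (by omega)) hi
    exact hz.exists_eq_of_map_eq hf h0 h1 hx (hxc 0 i.succ_pos) hm hfm

end IsPrimaryCycle

/-- for a primary `n(k)`-cycle `O`, `z 0 > 0`, `z (n-1) < 1`, and the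
closure `D` of the `c`-free backward orbit of `O` satisfies `D = O` iff
`z (k-1) ≠ f 0` and `z k ≠ f 1`. -/
theorem backward_orbit_closure_eq_cycle_iff
    (f : ℝ → ℝ) (c : ℝ) (n k : ℕ) (z : ℕ → ℝ)
    (hf : IsExpandingLorenz f c) (hz : IsPrimaryCycle f c n k z)
    (D : Set ℝ)
    (hD : D = closure {x ∈ Set.Icc (0:ℝ) 1 |
      ∃ i : ℕ, (∀ j < i, f^[j] x ≠ c) ∧ ∃ m < n, f^[i] x = z m}) :
    0 < z 0 ∧ z (n - 1) < 1 ∧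
    (D = {y : ℝ | ∃ m < n, z m = y} ↔ (z (k - 1) ≠ f 0 ∧ z k ≠ f 1)) := by
  have hkn := hz.k_lt_n
  have hk := hz.k_pos
  have hpos := hz.zero_lt hf
  have hlt := hz.last_lt_one hf
  refine ⟨hpos, hlt, fun hDO => ?_, fun ⟨h0, h1⟩ => ?_⟩
  · have key : ∀ x ∈ Icc (0 : ℝ) 1, x ≠ c → ∀ m < n, f x = z m → ∃ l < n, z l = x := by
      intro x hx hxc m hm hxm
      have hxD : x ∈ D := by
        rw [hD]
        refine subset_closure ⟨hx, 1, fun j hj => ?_, m, hm, hxm⟩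
        obtain rfl : j = 0 := by omega
        exact hxc
      rwa [hDO] at hxD
    constructor
    · intro h
      obtain ⟨l, hl, hl0⟩ := key 0 (by simp) hf.a_lt_c.ne (k - 1) (by omega) h.symm
      have := hz.le_of_le l.zero_le hl
      linarith
    · intro h
      obtain ⟨l, hl, hl1⟩ := key 1 (by simp) hf.c_lt_b.ne' k hkn h.symm
      have := hz.le_of_le (show l ≤ n - 1 by omega) (by omega)
      linarith
  · have hset : {x ∈ Icc (0 : ℝ) 1 | ∃ i : ℕ, (∀ j < i, f^[j] x ≠ c) ∧
        ∃ m < n, f^[i] x = z m} = z '' Iio n := by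
      ext x
      constructor
      · rintro ⟨hx, i, hxc, hi⟩
        obtain ⟨l, hl, rfl⟩ := hz.exists_eq_of_iterate_eq hf h0 h1 hx hxc hi
        exact ⟨l, hl, rfl⟩
      · rintro ⟨l, hl, rfl⟩
        exact ⟨hz.mem l hl, 0, by simp, l, hl, rfl⟩
    rw [hD, hset, ((finite_Iio n).image z).isClosed.closure_eq]
    rfl
end
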